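/- There exist constants C > 0, c > 0 and N such that for every odd n ≥ N: the μ_n-measure of the set of dice A satisfying |Pr_{B~μ_n}[A beats B] − 1/2| ≤ C·(log n)^c/√n is at least 1 − 1/n. -/

import Mathlib

open MeasureTheory ProbabilityTheory Set
open scoped ENNReal NNReal

noncomputable def extendDie (n : ℕ) (s : ℝ) (a : Fin (n - 1) → ℝ) : Fin n → ℝ :=
  fun i => if h : (i : ℕ) < n - 1 then a ⟨i, h⟩ else s - ∑ j, a j

noncomputable def diceMeasure (n : ℕ) (lo hi s : ℝ) : Measure (Fin n → ℝ) :=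
  Measure.map (extendDie n s)
    (ProbabilityTheory.cond volume
      {a : Fin (n - 1) → ℝ | (∀ i, a i ∈ Set.Icc lo hi) ∧ (s - ∑ i, a i) ∈ Set.Icc lo hi})

def beats {n : ℕ} (A B : Fin n → ℝ) : Prop :=
  0 < ∑ i : Fin n, ∑ j : Fin n,
      ((if B j < A i then (1 : ℝ) else 0) - (if A i < B j then (1 : ℝ) else 0))

/-- `|Im z^n| ≤ n |z|^(n-1) |Im z|`. -/
lemma abs_im_pow_le (z : ℂ) (n : ℕ) : |(z ^ (n+1)).im| ≤ (n+1) * ‖z‖ ^ n * |z.im| := by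
  induction n with
  | zero => simp
  | succ n ih =>
    rw [pow_succ, Complex.mul_im]
    have h1 : |(z^(n+1)).re| ≤ ‖z‖^(n+1) := by
      rw [← norm_pow]; exact Complex.abs_re_le_norm _
    have h2 : |z.re| ≤ ‖z‖ := Complex.abs_re_le_norm _
    calc |(z ^ (n + 1)).re * z.im + (z ^ (n + 1)).im * z.re|
        ≤ |(z ^ (n + 1)).re| * |z.im| + |(z ^ (n + 1)).im| * |z.re| := by
          rw [← abs_mul, ← abs_mul]; exact abs_add_le _ _
      _ ≤ ‖z‖^(n+1) * |z.im| + ((n+1) * ‖z‖ ^ n * |z.im|) * ‖z‖ := by gcongr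
      _ = _ := by push_cast; ring

lemma abs_sin_sub_self_le {x : ℝ} (hx : |x| ≤ 1) : |Real.sin x - x| ≤ x^2 * (11/48) := by
  have h := Real.sin_bound hx
  have hx2 : |x|^2 = x^2 := sq_abs x
  have h3 : |x|^3 ≤ x^2 := by
    rw [pow_succ, hx2]; nlinarith [abs_nonneg x, sq_nonneg x]
  have h4 : |x|^4 ≤ x^2 := by
    have e : |x|^4 = x^2 * x^2 := by rw [← hx2]; ring
    have e1 : x^2 ≤ 1 := by rw [← hx2]; exact pow_le_one₀ (abs_nonneg _) hx
    rw [e]; nlinarith [sq_nonneg x]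
  have : Real.sin x - x = (Real.sin x - (x - x^3/6)) + (- (x^3/6)) := by ring
  rw [this]
  have h5 : |x|^5 ≤ x^2 := by
    have : |x|^5 = |x|^4 * |x| := by ring
    rw [this]; nlinarith [abs_nonneg x, sq_nonneg x]
  have e3 : |-(x^3/6)| = |x|^3/6 := by rw [abs_neg, abs_div, abs_pow]; norm_num
  have := abs_add_le (Real.sin x - (x - x^3/6)) (- (x^3/6))
  rw [e3] at this
  nlinarith [sq_nonneg x]

lemma cos_le_quad {x : ℝ} (hx : |x| ≤ 1) : Real.cos x ≤ 1 - x^2 * (43/96) := by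
  have h := Real.cos_bound hx
  have hx2 : |x|^2 = x^2 := sq_abs x
  have h4 : |x|^4 ≤ x^2 := by
    have e : |x|^4 = x^2 * x^2 := by rw [← hx2]; ring
    have e1 : x^2 ≤ 1 := by rw [← hx2]; exact pow_le_one₀ (abs_nonneg _) hx
    rw [e]; nlinarith [sq_nonneg x]
  have := (abs_le.mp h).2
  nlinarith

/-- The characteristic function of a bounded centered variable. -/
lemma norm_charint_le {Ω : Type*} [MeasurableSpace Ω] (ν : Measure Ω) [IsProbabilityMeasure ν]
    (Y : Ω → ℝ) (hY : AEMeasurable Y ν) (hb : ∀ᵐ x ∂ν, |Y x| ≤ 1) (h0 : ∫ x, Y x ∂ν = 0) :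
    ‖∫ x, Complex.exp ((Y x : ℂ) * Complex.I) ∂ν‖ ≤ Real.exp (-(∫ x, (Y x)^2 ∂ν) / 5) := by
  have iY : Integrable Y ν := Integrable.of_bound hY.aestronglyMeasurable 1 hb
  have iY2 : Integrable (fun x => (Y x)^2) ν := by
    refine Integrable.of_bound (hY.pow_const 2).aestronglyMeasurable 1 ?_
    filter_upwards [hb] with x hx
    rw [Real.norm_eq_abs, abs_pow]; exact pow_le_one₀ (abs_nonneg _) hx
  have ic : Integrable (fun x => Real.cos (Y x)) ν :=
    Integrable.of_bound (Real.measurable_cos.comp_aemeasurable hY).aestronglyMeasurable 1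
      (ae_of_all _ fun x => Real.abs_cos_le_one _)
  have is : Integrable (fun x => Real.sin (Y x)) ν :=
    Integrable.of_bound (Real.measurable_sin.comp_aemeasurable hY).aestronglyMeasurable 1
      (ae_of_all _ fun x => Real.abs_sin_le_one _)
  have ie : Integrable (fun x => Complex.exp ((Y x : ℂ) * Complex.I)) ν := by
    refine Integrable.of_bound ?_ 1 (ae_of_all _ fun x => by
      rw [Complex.norm_exp_ofReal_mul_I])
    exact (by fun_prop : Measurable fun y : ℝ => Complex.exp ((y:ℂ) * Complex.I)).comp_aemeasurable hY
      |>.aestronglyMeasurable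
  set v := ∫ x, (Y x)^2 ∂ν with hv
  have v0 : 0 ≤ v := integral_nonneg fun x => sq_nonneg _
  have v1 : v ≤ 1 := by
    have : v ≤ ∫ x, (1:ℝ) ∂ν := by
      refine integral_mono_ae iY2 (integrable_const _) ?_
      filter_upwards [hb] with x hx
      rw [← sq_abs]; exact pow_le_one₀ (abs_nonneg _) hx
    simpa using this
  have hre : (∫ x, Complex.exp ((Y x : ℂ) * Complex.I) ∂ν).re = ∫ x, Real.cos (Y x) ∂ν := by
    rw [← RCLike.re_eq_complex_re, ← integral_re ie]
    simp [Complex.exp_ofReal_mul_I_re]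
  have him : (∫ x, Complex.exp ((Y x : ℂ) * Complex.I) ∂ν).im = ∫ x, Real.sin (Y x) ∂ν := by
    rw [← RCLike.im_eq_complex_im, ← integral_im ie]
    simp [Complex.exp_ofReal_mul_I_im]
  have hc1 : ∫ x, Real.cos (Y x) ∂ν ≤ 1 - v * (43/96) := by
    have : ∫ x, Real.cos (Y x) ∂ν ≤ ∫ x, (1 - (Y x)^2 * (43/96)) ∂ν := by
      refine integral_mono_ae ic ((integrable_const _).sub (iY2.mul_const _)) ?_
      filter_upwards [hb] with x hx using cos_le_quad hx
    rw [integral_sub (integrable_const _) (iY2.mul_const _), integral_mul_const] at this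
    simpa using this
  have hc0 : 0 ≤ ∫ x, Real.cos (Y x) ∂ν := by
    apply integral_nonneg_of_ae
    filter_upwards [hb] with x hx
    have := Real.one_sub_sq_div_two_le_cos (x := Y x)
    have h2 : (Y x)^2 ≤ 1 := by rw [← sq_abs]; exact pow_le_one₀ (abs_nonneg _) hx
    simp only [Pi.zero_apply]; linarith
  have hs1 : |∫ x, Real.sin (Y x) ∂ν| ≤ v * (11/48) := by
    have e : ∫ x, Real.sin (Y x) ∂ν = ∫ x, (Real.sin (Y x) - Y x) ∂ν := by
      rw [integral_sub is iY, h0, sub_zero]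
    rw [e, hv, ← integral_mul_const, ← Real.norm_eq_abs]
    refine norm_integral_le_of_norm_le (iY2.mul_const _) ?_
    filter_upwards [hb] with x hx using abs_sin_sub_self_le hx
  set z := ∫ x, Complex.exp ((Y x : ℂ) * Complex.I) ∂ν with hz
  have hn : ‖z‖^2 ≤ 1 - 2*v/5 := by
    rw [Complex.sq_norm, Complex.normSq_apply, hre, him]
    have a1 : (∫ x, Real.sin (Y x) ∂ν) * (∫ x, Real.sin (Y x) ∂ν) ≤ (v * (11/48))^2 := by
      rw [← sq, ← sq_abs]; gcongr
    have a2 : (∫ x, Real.cos (Y x) ∂ν) * (∫ x, Real.cos (Y x) ∂ν) ≤ (1 - v * (43/96))^2 := by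
      rw [← sq]; gcongr
    nlinarith
  have hexp : ‖z‖^2 ≤ (Real.exp (-v/5))^2 := by
    refine hn.trans ?_
    rw [← Real.exp_nat_mul]
    have := Real.add_one_le_exp (((2:ℕ):ℝ) * (-v/5))
    push_cast at *
    linarith
  exact le_of_sq_le_sq hexp (Real.exp_pos _).le
where
  le_of_sq_le_sq {a b : ℝ} (h : a^2 ≤ b^2) (hb : 0 ≤ b) : a ≤ b := abs_le_of_sq_le_sq' h hb |>.2

/-- Gaussian integral of a Gaussian. -/
lemma gauss_int_exp (b : ℝ) (hb : -(1/2) < b) :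
    Integrable (fun x : ℝ => Real.exp (-b * x^2)) (gaussianReal 0 1) ∧
    ∫ x, Real.exp (-b * x^2) ∂(gaussianReal 0 1) = (Real.sqrt (1 + 2*b))⁻¹ := by
  have hpdf : ∀ x, gaussianPDFReal 0 1 x * Real.exp (-b * x^2)
      = (Real.sqrt (2 * Real.pi))⁻¹ * Real.exp (-(1/2 + b) * x^2) := by
    intro x
    rw [gaussianPDFReal]
    simp only [NNReal.coe_one, mul_one, sub_zero]
    rw [mul_assoc, ← Real.exp_add]
    congr 2; ring
  constructor
  · rw [gaussianReal_of_var_ne_zero _ one_ne_zero, gaussianPDF_def]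
    rw [integrable_withDensity_iff_integrable_smul₀' (by fun_prop) (by simp)]
    simp only [smul_eq_mul]
    have : (fun x => gaussianPDFReal 0 1 x * Real.exp (-b * x^2)) =
      fun x => (Real.sqrt (2 * Real.pi))⁻¹ * Real.exp (-(1/2 + b) * x^2) := funext hpdf
    refine Integrable.congr ((integrable_exp_neg_mul_sq (b := 1/2 + b) (by linarith)).const_mul
      (Real.sqrt (2 * Real.pi))⁻¹) (ae_of_all _ fun x => ?_)
    have := (hpdf x).symm
    simpa [gaussianPDF, ENNReal.toReal_ofReal (gaussianPDFReal_nonneg 0 1 x)] using this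
  · rw [integral_gaussianReal_eq_integral_smul one_ne_zero]
    simp only [smul_eq_mul, hpdf]
    rw [integral_const_mul, integral_gaussian]
    rw [← Real.sqrt_inv, ← Real.sqrt_inv, ← Real.sqrt_mul (by positivity)]
    congr 1
    have : (1/2 + b) ≠ 0 := by linarith
    have h2 : 1 + 2*b ≠ 0 := by linarith
    field_simp

lemma gauss_char (t : ℝ) : ∫ x, Complex.exp (((x * t : ℝ) : ℂ) * Complex.I) ∂(gaussianReal 0 1)
    = Complex.exp (-((t:ℂ)^2)/2) := by
  have := charFun_gaussianReal (μ := 0) (v := 1) t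
  rw [charFun_apply_real] at this
  simp only [NNReal.coe_one, Complex.ofReal_zero, mul_zero, zero_mul, Complex.ofReal_one, one_mul, zero_sub] at this
  rw [← neg_div] at this
  rw [← this]
  congr 1; ext x; push_cast; ring_nf

lemma gauss_cos (t : ℝ) : ∫ x, Real.cos (x * t) ∂(gaussianReal 0 1) = Real.exp (-(t^2)/2) := by
  have h := gauss_char t
  have ie : Integrable (fun x : ℝ => Complex.exp (((x * t : ℝ) : ℂ) * Complex.I)) (gaussianReal 0 1) := by
    refine Integrable.of_bound (by fun_prop) 1 (ae_of_all _ fun x => by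
      rw [Complex.norm_exp_ofReal_mul_I])
  have h2 := congrArg Complex.re h
  rw [← RCLike.re_eq_complex_re, ← integral_re ie] at h2
  simp only [RCLike.re_eq_complex_re, Complex.exp_ofReal_mul_I_re] at h2
  rw [h2]
  have : -((t:ℂ)^2)/2 = ((-(t^2)/2 : ℝ) : ℂ) := by push_cast; ring
  rw [this, ← Complex.ofReal_exp, Complex.ofReal_re]

noncomputable def erfH (z : ℝ) : ℝ :=
  Real.sqrt (2/Real.pi) * ∫ ξ, Real.sin (ξ * z) / ξ ∂(gaussianReal 0 1)

lemma abs_sin_div_le (ξ z : ℝ) : |Real.sin (ξ * z) / ξ| ≤ |z| := by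
  by_cases h : ξ = 0
  · simp [h]
  · rw [abs_div, div_le_iff₀ (abs_pos.mpr h)]
    calc _ ≤ |ξ * z| := Real.abs_sin_le_abs
      _ = _ := by rw [abs_mul, mul_comm]

lemma sin_div_eq (ξ z : ℝ) (h : ξ ≠ 0) : Real.sin (ξ * z) / ξ = ∫ u in (0:ℝ)..z, Real.cos (ξ * u) := by
  rw [intervalIntegral.integral_comp_mul_left (fun x => Real.cos x) h]
  simp [integral_cos, div_eq_inv_mul]

lemma erfH_eq (z : ℝ) : erfH z = Real.sqrt (2/Real.pi) * ∫ u in (0:ℝ)..z, Real.exp (-(u^2)/2) := by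
  unfold erfH
  congr 1
  have hne : ∀ᵐ ξ ∂(gaussianReal 0 1), ξ ≠ 0 := by
    have : NullSingletonClass (gaussianReal 0 1) := nullSingletonClass_gaussianReal one_ne_zero
    rw [ae_iff]; simp
  have : ∫ ξ, Real.sin (ξ * z) / ξ ∂(gaussianReal 0 1)
      = ∫ ξ, (∫ u in (0:ℝ)..z, Real.cos (ξ * u)) ∂(gaussianReal 0 1) := by
    apply integral_congr_ae
    filter_upwards [hne] with ξ hξ using sin_div_eq ξ z hξ
  rw [this]
  have : ∀ u, Real.exp (-(u^2)/2) = ∫ ξ, Real.cos (ξ * u) ∂(gaussianReal 0 1) := fun u => (gauss_cos u).symm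
  simp_rw [this]
  rw [← intervalIntegral_integral_swap]
  have : IsFiniteMeasure (volume.restrict (uIoc 0 z)) := by
    constructor; simp [uIoc]
  refine Integrable.of_bound (Continuous.aestronglyMeasurable (by fun_prop)) 1 (ae_of_all _ fun x => ?_)
  exact Real.abs_cos_le_one _

lemma erfH_neg (z : ℝ) : erfH (-z) = - erfH z := by
  unfold erfH
  rw [← mul_neg, ← integral_neg]
  congr 2; ext ξ; rw [mul_neg, Real.sin_neg, neg_div]

lemma one_sub_erfH (z : ℝ) (hz : 0 ≤ z) : |1 - erfH z| ≤ Real.exp (-(z^2)/2) := by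
  have hf : ∀ u : ℝ, Real.exp (-(u^2)/2) = Real.exp (-(1/2) * u^2) := fun u => by congr 1; ring
  have hi : Integrable (fun u : ℝ => Real.exp (-(u^2)/2)) := by
    simp_rw [hf]; exact integrable_exp_neg_mul_sq (by norm_num)
  have htot : ∫ u in Ioi (0:ℝ), Real.exp (-(u^2)/2) = Real.sqrt (Real.pi/2) := by
    simp_rw [hf]; rw [integral_gaussian_Ioi]
    rw [show Real.pi / (1/2) = 2^2 * (Real.pi/2) by ring, Real.sqrt_mul (by norm_num),
      Real.sqrt_sq (by norm_num)]
    ring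
  have hsplit := intervalIntegral.integral_interval_add_Ioi (a := 0) (b := z) (μ := volume)
    (f := fun u : ℝ => Real.exp (-(u^2)/2)) hi.integrableOn hi.integrableOn
  have hmul : Real.sqrt (2/Real.pi) * Real.sqrt (Real.pi/2) = 1 := by
    rw [← Real.sqrt_mul (by positivity)]
    rw [show 2/Real.pi * (Real.pi/2) = 1 by field_simp]; simp
  have e : 1 - erfH z = Real.sqrt (2/Real.pi) * ∫ u in Ioi z, Real.exp (-(u^2)/2) := by
    rw [erfH_eq, ← hmul, ← htot, ← hsplit]; ring
  have hpos : 0 ≤ ∫ u in Ioi z, Real.exp (-(u^2)/2) := integral_nonneg fun u => (Real.exp_pos _).le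
  rw [e, abs_of_nonneg (by positivity)]
  have hle : ∫ u in Ioi z, Real.exp (-(u^2)/2) ≤ Real.exp (-(z^2)/2) * Real.sqrt (Real.pi/2) := by
    rw [← htot, ← integral_const_mul]
    have := (measurePreserving_add_right (volume : Measure ℝ) z).setIntegral_preimage_emb
      (measurableEmbedding_addRight z) (fun u : ℝ => Real.exp (-(u^2)/2)) (Ioi z)
    rw [show (fun x : ℝ => x + z) ⁻¹' Ioi z = Ioi 0 by ext x; simp] at this
    rw [← this]
    refine setIntegral_mono_on (hi.comp_add_right z).integrableOn
      (hi.const_mul _).integrableOn measurableSet_Ioi fun u hu => ?_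
    rw [← Real.exp_add]
    apply Real.exp_le_exp.mpr
    have : 0 ≤ u * z := mul_nonneg (le_of_lt hu) hz
    nlinarith
  calc _ ≤ Real.sqrt (2/Real.pi) * (Real.exp (-(z^2)/2) * Real.sqrt (Real.pi/2)) := by gcongr
    _ = Real.exp (-(z^2)/2) * (Real.sqrt (2/Real.pi) * Real.sqrt (Real.pi/2)) := by ring
    _ = _ := by rw [hmul, mul_one]

lemma ind_sub_erfH (z : ℝ) : |(if 0 < z then (1:ℝ) else 0) - 1/2 - erfH z / 2| ≤ Real.exp (-(z^2)/2) := by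
  rcases lt_trichotomy z 0 with h | h | h
  · have := one_sub_erfH (-z) (by linarith)
    rw [erfH_neg, neg_sq] at this
    rw [if_neg (by linarith)]
    have e : (0:ℝ) - 1/2 - erfH z / 2 = -(1/2) * (1 - - erfH z) := by ring
    rw [e, abs_mul]
    norm_num at *
    linarith [abs_nonneg (1 + erfH z)]
  · subst h
    simp [erfH]; norm_num
  · have := one_sub_erfH z h.le
    rw [if_pos h]
    have e : (1:ℝ) - 1/2 - erfH z / 2 = (1/2) * (1 - erfH z) := by ring
    rw [e, abs_mul]
    norm_num at *
    linarith [abs_nonneg (1 - erfH z)]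

lemma smoothing {Ω : Type*} [MeasurableSpace Ω] (P : Measure Ω) [IsProbabilityMeasure P]
    (X : Ω → ℝ) (hX : Measurable X) (M : ℝ) (hM : ∀ ω, |X ω| ≤ M) (b1 b2 : ℝ → ℝ)
    (hb1 : Integrable b1 (gaussianReal 0 1)) (hb2 : Integrable b2 (gaussianReal 0 1))
    (h1 : ∀ ξ, ξ ≠ 0 → |∫ ω, Real.sin (ξ * X ω) ∂P| ≤ |ξ| * b1 ξ)
    (h2 : ∀ ξ, |∫ ω, Real.cos (ξ * X ω) ∂P| ≤ b2 ξ) :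
    |P.real {ω | 0 < X ω} - 1/2| ≤ ∫ ξ, b1 ξ ∂(gaussianReal 0 1) + ∫ ξ, b2 ξ ∂(gaussianReal 0 1) := by
  have hms : MeasurableSet {ω | 0 < X ω} := measurableSet_lt measurable_const hX
  -- cos part
  have ic2 : Integrable (fun p : ℝ × Ω => Real.cos (p.1 * X p.2)) ((gaussianReal 0 1).prod P) :=
    Integrable.of_bound (by fun_prop) 1 (ae_of_all _ fun p => Real.abs_cos_le_one _)
  have hexpE : ∫ ω, Real.exp (-(X ω ^2)/2) ∂P ≤ ∫ ξ, b2 ξ ∂(gaussianReal 0 1) := by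
    have : ∫ ω, Real.exp (-(X ω ^2)/2) ∂P = ∫ ω, ∫ ξ, Real.cos (ξ * X ω) ∂(gaussianReal 0 1) ∂P := by
      congr 1; ext ω; rw [gauss_cos]
    rw [this, ← integral_integral_swap ic2]
    refine (le_abs_self _).trans ?_
    rw [← Real.norm_eq_abs]
    exact norm_integral_le_of_norm_le hb2 (ae_of_all _ fun ξ => h2 ξ)
  have is2 : Integrable (fun p : ℝ × Ω => Real.sin (p.1 * X p.2) / p.1) ((gaussianReal 0 1).prod P) := by
    refine Integrable.of_bound (Measurable.aestronglyMeasurable ?_) M (ae_of_all _ fun p => ?_)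
    · exact (Real.measurable_sin.comp (measurable_fst.mul (hX.comp measurable_snd))).div measurable_fst
    · exact (abs_sin_div_le _ _).trans (hM _)
  have herf : |∫ ω, erfH (X ω) ∂P| ≤ ∫ ξ, b1 ξ ∂(gaussianReal 0 1) := by
    unfold erfH
    rw [integral_const_mul, ← integral_integral_swap is2, abs_mul]
    have hs : |Real.sqrt (2/Real.pi)| ≤ 1 := by
      rw [abs_of_nonneg (Real.sqrt_nonneg _), Real.sqrt_le_one, div_le_one Real.pi_pos]
      linarith [Real.pi_gt_three]
    have hb : |∫ ξ, ∫ ω, Real.sin (ξ * X ω) / ξ ∂P ∂(gaussianReal 0 1)| ≤ ∫ ξ, b1 ξ ∂(gaussianReal 0 1) := by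
      rw [← Real.norm_eq_abs]
      refine norm_integral_le_of_norm_le hb1 ?_
      have : NullSingletonClass (gaussianReal 0 1) := nullSingletonClass_gaussianReal one_ne_zero
      have hne : ∀ᵐ ξ ∂(gaussianReal 0 1), ξ ≠ 0 := by
        rw [ae_iff]; simp
      filter_upwards [hne] with ξ hξ
      rw [integral_div, Real.norm_eq_abs, abs_div, div_le_iff₀ (abs_pos.mpr hξ), mul_comm]
      exact h1 ξ hξ
    calc _ ≤ 1 * _ := mul_le_mul_of_nonneg_right hs (abs_nonneg _)
      _ ≤ _ := by rw [one_mul]; exact hb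
  have ierf : Integrable (fun ω => erfH (X ω)) P := by
    unfold erfH
    exact (is2.swap.integral_prod_left).const_mul _
  have iind : Integrable (fun ω => if 0 < X ω then (1:ℝ) else 0) P :=
    Integrable.of_bound (Measurable.ite hms measurable_const measurable_const).aestronglyMeasurable 1
      (ae_of_all _ fun ω => by split_ifs <;> simp)
  have hind : P.real {ω | 0 < X ω} = ∫ ω, (if 0 < X ω then (1:ℝ) else 0) ∂P := by
    rw [← integral_indicator_one hms]
    rfl
  have iexp : Integrable (fun ω => Real.exp (-(X ω ^2)/2)) P := by
    refine Integrable.of_bound (by fun_prop) 1 (ae_of_all _ fun ω => ?_)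
    rw [Real.norm_eq_abs, Real.abs_exp, Real.exp_le_one_iff]
    have := sq_nonneg (X ω); linarith
  have hmain : |∫ ω, ((if 0 < X ω then (1:ℝ) else 0) - 1/2 - erfH (X ω) / 2) ∂P|
      ≤ ∫ ω, Real.exp (-(X ω ^2)/2) ∂P := by
    rw [← Real.norm_eq_abs]
    exact norm_integral_le_of_norm_le iexp (ae_of_all _ fun ω => ind_sub_erfH (X ω))
  have i3 : Integrable (fun ω => (if 0 < X ω then (1:ℝ) else 0) - 1/2) P :=
    iind.sub (integrable_const _)
  rw [integral_sub i3 (ierf.div_const _), integral_sub iind (integrable_const _), ← hind, integral_div (2:ℝ) (fun ω => erfH (X ω))] at hmain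
  simp only [integral_const, probReal_univ, smul_eq_mul, one_mul] at hmain
  have e : P.real {ω | 0 < X ω} - 1/2 = (P.real {ω | 0 < X ω} - 1/2 - (∫ ω, erfH (X ω) ∂P) / 2)
    + (∫ ω, erfH (X ω) ∂P) / 2 := by ring
  rw [e]
  refine (abs_add_le _ _).trans ?_
  rw [abs_div, abs_two]
  have := abs_nonneg (∫ ω, erfH (X ω) ∂P)
  linarith

/-- characteristic function of `s g(x) + t (x - 1/2)` for uniform `x` -/
noncomputable def Phi (g : ℝ → ℝ) (s t : ℝ) : ℂ :=
  ∫ x in Ioc (0:ℝ) 1, Complex.exp (((s * g x + t * (x - 1/2) : ℝ) : ℂ) * Complex.I)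

instance unif_prob : IsProbabilityMeasure (volume.restrict (Ioc (0:ℝ) 1)) := ⟨by simp⟩

lemma Phi_L2_gauss (g : ℝ → ℝ) (hg : Measurable g) (s T : ℝ) (hT : 0 < T) :
    ∫ ξ, ‖Phi g s (T * ξ)‖^2 ∂(gaussianReal 0 1) ≤ Real.sqrt (2 * Real.pi) / T := by
  set ν := volume.restrict (Ioc (0:ℝ) 1) with hν
  let θ : ℝ × ℝ → ℝ := fun p => s * g p.1 - s * g p.2
  have key : ∀ ξ, ((‖Phi g s (T * ξ)‖^2 : ℝ) : ℂ) = ∫ p, Complex.exp ((θ p : ℂ) * Complex.I) *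
      Complex.exp (((ξ * (T * (p.1 - p.2)) : ℝ) : ℂ) * Complex.I) ∂(ν.prod ν) := by
    intro ξ
    have h1 : ((‖Phi g s (T * ξ)‖^2 : ℝ) : ℂ) = Phi g s (T*ξ) * (starRingEnd ℂ) (Phi g s (T*ξ)) := by
      rw [Complex.mul_conj, Complex.normSq_eq_norm_sq]
    rw [h1]
    have h2 : (starRingEnd ℂ) (Phi g s (T*ξ)) =
        ∫ x, Complex.exp (-(((s * g x + (T*ξ) * (x - 1/2) : ℝ) : ℂ) * Complex.I)) ∂ν := by
      unfold Phi
      rw [← integral_conj]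
      congr 1; ext x
      rw [← Complex.exp_conj]
      congr 1
      rw [map_mul, Complex.conj_I, Complex.conj_ofReal]; ring
    rw [h2]
    unfold Phi
    rw [← hν, ← integral_prod_mul (μ := ν) (ν := ν)]
    congr 1; ext p
    rw [← Complex.exp_add, ← Complex.exp_add]
    congr 1
    simp only [θ]
    push_cast; ring
  have hIntg : Integrable (fun q : ℝ × (ℝ × ℝ) => Complex.exp ((θ q.2 : ℂ) * Complex.I) *
      Complex.exp (((q.1 * (T * (q.2.1 - q.2.2)) : ℝ) : ℂ) * Complex.I))
      ((gaussianReal 0 1).prod (ν.prod ν)) := by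
    refine Integrable.of_bound (by fun_prop) 1 (ae_of_all _ fun q => ?_)
    rw [norm_mul, Complex.norm_exp_ofReal_mul_I, Complex.norm_exp_ofReal_mul_I, one_mul]
  have hswap : ((∫ ξ, ‖Phi g s (T * ξ)‖^2 ∂(gaussianReal 0 1) : ℝ) : ℂ)
      = ∫ p, Complex.exp ((θ p : ℂ) * Complex.I) * Complex.exp (-(((T * (p.1 - p.2) : ℝ):ℂ)^2)/2) ∂(ν.prod ν) := by
    rw [← integral_complex_ofReal]
    simp_rw [key]
    rw [integral_integral_swap hIntg]
    congr 1; ext p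
    rw [integral_const_mul, gauss_char]
  have hnn : 0 ≤ ∫ ξ, ‖Phi g s (T * ξ)‖^2 ∂(gaussianReal 0 1) := integral_nonneg fun _ => by positivity
  have hnorm : ∫ ξ, ‖Phi g s (T * ξ)‖^2 ∂(gaussianReal 0 1)
      ≤ ∫ p, Real.exp (-(T^2/2) * (p.1 - p.2)^2) ∂(ν.prod ν) := by
    have h := norm_integral_le_integral_norm (μ := ν.prod ν) (fun p => Complex.exp ((θ p : ℂ) * Complex.I) * Complex.exp (-(((T * (p.1 - p.2) : ℝ):ℂ)^2)/2))
    rw [← hswap, Complex.norm_real, Real.norm_of_nonneg hnn] at h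
    refine h.trans (le_of_eq ?_)
    congr 1; ext p
    rw [norm_mul, Complex.norm_exp_ofReal_mul_I, one_mul, Complex.norm_exp]
    congr 1
    have : -((((T * (p.1 - p.2) : ℝ):ℂ))^2)/2 = ((-((T * (p.1 - p.2))^2)/2 : ℝ) : ℂ) := by push_cast; ring
    rw [this, Complex.ofReal_re]; ring
  refine hnorm.trans ?_
  have hi2 : Integrable (fun p : ℝ × ℝ => Real.exp (-(T^2/2) * (p.1 - p.2)^2)) (ν.prod ν) := by
    refine Integrable.of_bound (by fun_prop) 1 (ae_of_all _ fun q => ?_)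
    rw [Real.norm_eq_abs, Real.abs_exp, Real.exp_le_one_iff]
    have : 0 ≤ (T^2/2) * (q.1 - q.2)^2 := by positivity
    linarith
  rw [integral_prod _ hi2]
  have hT2 : 0 < T^2/2 := by positivity
  have hval : Real.sqrt (Real.pi / (T^2/2)) = Real.sqrt (2 * Real.pi) / T := by
    rw [show Real.pi / (T^2/2) = (2 * Real.pi) / T^2 by field_simp, Real.sqrt_div (by positivity), Real.sqrt_sq hT.le]
  have hin : ∀ x : ℝ, ∫ y, Real.exp (-(T^2/2) * (x - y)^2) ∂ν ≤ Real.sqrt (2 * Real.pi) / T := by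
    intro x
    have hii : Integrable (fun y : ℝ => Real.exp (-(T^2/2) * (x - y)^2)) :=
      (integrable_exp_neg_mul_sq hT2).comp_sub_left x
    have := setIntegral_le_integral (s := Ioc (0:ℝ) 1) hii (ae_of_all _ fun y => (Real.exp_pos _).le)
    refine this.trans (le_of_eq ?_)
    rw [integral_sub_left_eq_self (fun y : ℝ => Real.exp (-(T^2/2) * y^2)), integral_gaussian, hval]
  calc _ ≤ ∫ x, Real.sqrt (2 * Real.pi) / T ∂ν := by
        refine integral_mono hi2.integral_prod_left (integrable_const _) hin
    _ = _ := by simp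

lemma Phi_continuous (g : ℝ → ℝ) (hg : Measurable g) (s : ℝ) : Continuous (Phi g s) := by
  unfold Phi
  refine continuous_of_dominated (bound := fun _ => 1) (fun t => ?_) (fun t => ae_of_all _ fun x => ?_)
    (integrable_const _) (ae_of_all _ fun x => by fun_prop)
  · exact Measurable.aestronglyMeasurable (by fun_prop)
  · rw [Complex.norm_exp_ofReal_mul_I]

lemma Phi_norm_le_one (g : ℝ → ℝ) (s t : ℝ) : ‖Phi g s t‖ ≤ 1 := by
  unfold Phi
  refine (norm_integral_le_integral_norm _).trans ?_
  simp_rw [Complex.norm_exp_ofReal_mul_I]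
  simp

lemma Phi_L2 (g : ℝ → ℝ) (hg : Measurable g) (s : ℝ) :
    Integrable (fun t => ‖Phi g s t‖^2) ∧ ∫ t, ‖Phi g s t‖^2 ≤ 2 * Real.pi := by
  have hc : Continuous (fun t => ‖Phi g s t‖^2) := (Phi_continuous g hg s).norm.pow 2
  have hT : ∀ k : ℕ, ∫ t, ‖Phi g s t‖^2 * Real.exp (-(t^2) / (2 * ((k:ℝ)+1)^2)) ≤ 2 * Real.pi := by
    intro k
    have hk : (0:ℝ) < k + 1 := by positivity
    have h := Phi_L2_gauss g hg s (k+1) hk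
    rw [integral_gaussianReal_eq_integral_smul one_ne_zero] at h
    have e : ∀ ξ : ℝ, gaussianPDFReal 0 1 ξ • ‖Phi g s ((k+1) * ξ)‖^2 =
        (fun t => (Real.sqrt (2 * Real.pi))⁻¹ * (‖Phi g s t‖^2 * Real.exp (-(t^2) / (2 * ((k:ℝ)+1)^2)))) ((k+1) * ξ) := by
      intro ξ
      simp only [gaussianPDFReal, NNReal.coe_one, mul_one, sub_zero, smul_eq_mul]
      have : -((((k:ℝ)+1) * ξ)^2) / (2 * ((k:ℝ)+1)^2) = -(ξ^2)/2 := by field_simp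
      rw [this]; ring
    rw [integral_congr_ae (ae_of_all _ e), Measure.integral_comp_mul_left (fun t => (Real.sqrt (2 * Real.pi))⁻¹ * (‖Phi g s t‖^2 * Real.exp (-(t^2) / (2 * ((k:ℝ)+1)^2)))), integral_const_mul, abs_of_pos (by positivity), smul_eq_mul] at h
    rw [le_div_iff₀ hk] at h
    have hs : 0 < Real.sqrt (2 * Real.pi) := by positivity
    have e2 : ((k:ℝ)+1)⁻¹ * ((Real.sqrt (2 * Real.pi))⁻¹ * ∫ t, ‖Phi g s t‖^2 * Real.exp (-(t^2) / (2 * ((k:ℝ)+1)^2))) * (k+1)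
       = (∫ t, ‖Phi g s t‖^2 * Real.exp (-(t^2) / (2 * ((k:ℝ)+1)^2))) / Real.sqrt (2 * Real.pi) := by
      field_simp
    rw [e2, div_le_iff₀ hs, Real.mul_self_sqrt (by positivity)] at h
    exact h
  have hl : ∫⁻ t, ENNReal.ofReal (‖Phi g s t‖^2) ≤ ENNReal.ofReal (2 * Real.pi) := by
    have hlim : ∀ t, Filter.Tendsto (fun k : ℕ => ENNReal.ofReal (‖Phi g s t‖^2 * Real.exp (-(t^2) / (2 * ((k:ℝ)+1)^2))))
        Filter.atTop (nhds (ENNReal.ofReal (‖Phi g s t‖^2))) := by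
      intro t
      apply ENNReal.tendsto_ofReal
      have h0 : Filter.Tendsto (fun k : ℕ => -(t^2) / (2 * ((k:ℝ)+1)^2)) Filter.atTop (nhds 0) := by
        apply Filter.Tendsto.div_atTop tendsto_const_nhds
        apply Filter.Tendsto.const_mul_atTop (by norm_num)
        exact (Filter.tendsto_pow_atTop two_ne_zero).comp
          (Filter.tendsto_atTop_add_const_right _ _ tendsto_natCast_atTop_atTop)
      have := (Real.continuous_exp.tendsto 0).comp h0
      rw [Real.exp_zero] at this
      simpa using this.const_mul (‖Phi g s t‖^2)
    calc ∫⁻ t, ENNReal.ofReal (‖Phi g s t‖^2)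
        = ∫⁻ t, Filter.liminf (fun k : ℕ => ENNReal.ofReal (‖Phi g s t‖^2 * Real.exp (-(t^2) / (2 * ((k:ℝ)+1)^2)))) Filter.atTop := by
          congr 1; ext t; exact (hlim t).liminf_eq.symm
      _ ≤ Filter.liminf (fun k : ℕ => ∫⁻ t, ENNReal.ofReal (‖Phi g s t‖^2 * Real.exp (-(t^2) / (2 * ((k:ℝ)+1)^2)))) Filter.atTop := by
          apply lintegral_liminf_le
          intro k
          exact (ENNReal.continuous_ofReal.comp (hc.mul (by fun_prop))).measurable
      _ ≤ Filter.liminf (fun k : ℕ => ENNReal.ofReal (2 * Real.pi)) Filter.atTop := by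
          refine Filter.liminf_le_liminf (Filter.Eventually.of_forall fun k => ?_)
          show ∫⁻ t, ENNReal.ofReal (‖Phi g s t‖^2 * Real.exp (-(t^2) / (2 * ((k:ℝ)+1)^2))) ≤ _
          rw [← ofReal_integral_eq_lintegral_ofReal]
          · exact ENNReal.ofReal_le_ofReal (hT k)
          · have hi : Integrable (fun t : ℝ => Real.exp (-(t^2) / (2 * ((k:ℝ)+1)^2))) := by
              have := integrable_exp_neg_mul_sq (b := 1 / (2 * ((k:ℝ)+1)^2)) (by positivity)
              refine this.congr (ae_of_all _ fun t => ?_)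
              show Real.exp _ = Real.exp _
              congr 1; ring
            refine hi.bdd_mul (c := 1) hc.aestronglyMeasurable (ae_of_all _ fun t => ?_)
            rw [Real.norm_of_nonneg (by positivity)]
            exact pow_le_one₀ (norm_nonneg _) (Phi_norm_le_one g s t)
          · exact ae_of_all _ fun t => by positivity
      _ = _ := by simp
  have hIntg : Integrable (fun t => ‖Phi g s t‖^2) := by
    refine ⟨hc.aestronglyMeasurable, ?_⟩
    rw [hasFiniteIntegral_iff_ofReal (ae_of_all _ fun t => by positivity)]
    exact hl.trans_lt ENNReal.ofReal_lt_top
  refine ⟨hIntg, ?_⟩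
  rw [← ofReal_integral_eq_lintegral_ofReal hIntg (ae_of_all _ fun t => by positivity)] at hl
  exact (ENNReal.ofReal_le_ofReal_iff (by positivity)).mp hl

open scoped ENNReal NNReal FourierTransform

lemma hyperplane_null (N : ℕ) (hN : 0 < N) (c : ℝ) :
    (volume : Measure (Fin N → ℝ)) {a | ∑ i, a i = c} = 0 := by
  let ℓ : (Fin N → ℝ) →ₗ[ℝ] ℝ := ∑ i, LinearMap.proj i
  have hℓ : ∀ a, ℓ a = ∑ i, a i := fun a => by simp [ℓ, LinearMap.sum_apply]
  let p : Fin N → ℝ := Pi.single ⟨0, hN⟩ c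
  let p1 : Fin N → ℝ := Pi.single ⟨0, hN⟩ (c+1)
  have hp : ∑ i, p i = c := by simp [p]
  have hp1 : ∑ i, p1 i = c + 1 := by simp [p1]
  have hs : {a : Fin N → ℝ | ∑ i, a i = c} = (AffineSubspace.mk' p (LinearMap.ker ℓ) : Set (Fin N → ℝ)) := by
    ext a
    simp only [mem_ofPred_eq, SetLike.mem_coe, AffineSubspace.mem_mk', LinearMap.mem_ker, vsub_eq_sub, hℓ,
      Pi.sub_apply, Finset.sum_sub_distrib, hp, sub_eq_zero]
  rw [hs]
  apply Measure.addHaar_affineSubspace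
  intro h
  have : p1 ∈ (AffineSubspace.mk' p (LinearMap.ker ℓ) : Set (Fin N → ℝ)) := by rw [h]; trivial
  rw [← hs, mem_ofPred_eq, hp1] at this
  linarith

section conv
variable (k : ℝ → ℂ) (N : ℕ)

noncomputable def convp (y : ℝ) : ℂ := ∫ a : Fin N → ℝ, (∏ i, k (a i)) * k (y - ∑ i, a i)

lemma convp_joint_integrable (hk : Measurable k) (hb : ∀ x, ‖k x‖ ≤ 1) (h0 : ∀ x, x ∉ Icc (0:ℝ) 1 → k x = 0) :
    Integrable (fun q : ℝ × (Fin N → ℝ) => (∏ i, k (q.2 i)) * k (q.1 - ∑ i, q.2 i)) := by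
  let S : Set (ℝ × (Fin N → ℝ)) := (Icc (0:ℝ) (N+1)) ×ˢ (Icc 0 1)
  have hS : MeasurableSet S := measurableSet_Icc.prod measurableSet_Icc
  have hSf : volume S < ∞ := by
    have : IsCompact S := isCompact_Icc.prod isCompact_Icc
    exact this.measure_lt_top
  have hi : Integrable (S.indicator (fun _ => (1:ℝ))) := by
    rw [integrable_indicator_iff hS]
    exact integrableOn_const hSf.ne
  refine hi.mono' ?_ (ae_of_all _ fun q => ?_)
  · refine Measurable.aestronglyMeasurable (Measurable.mul ?_ ?_)
    · exact Finset.measurable_prod _ fun i _ => hk.comp ((measurable_pi_apply i).comp measurable_snd)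
    · exact hk.comp (by fun_prop)
  · by_cases hq : q ∈ S
    · rw [indicator_of_mem hq, norm_mul, norm_prod]
      have : ∏ i, ‖k (q.2 i)‖ ≤ 1 := Finset.prod_le_one (fun _ _ => norm_nonneg _) fun i _ => hb _
      exact mul_le_one₀ this (norm_nonneg _) (hb _)
    · rw [indicator_of_notMem hq]
      have : (∏ i, k (q.2 i)) * k (q.1 - ∑ i, q.2 i) = 0 := by
        by_contra hne
        apply hq
        have h1 : (∏ i, k (q.2 i)) ≠ 0 := left_ne_zero_of_mul hne
        have h2 : k (q.1 - ∑ i, q.2 i) ≠ 0 := right_ne_zero_of_mul hne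
        rw [Finset.prod_ne_zero_iff] at h1
        have h3 : ∀ i, q.2 i ∈ Icc (0:ℝ) 1 := fun i => by
          by_contra hc; exact h1 i (Finset.mem_univ _) (h0 _ hc)
        have h4 : q.1 - ∑ i, q.2 i ∈ Icc (0:ℝ) 1 := by
          by_contra hc; exact h2 (h0 _ hc)
        have h5 : 0 ≤ ∑ i, q.2 i := Finset.sum_nonneg fun i _ => (h3 i).1
        have h6 : ∑ i, q.2 i ≤ N := by
          calc ∑ i, q.2 i ≤ ∑ i : Fin N, (1:ℝ) := Finset.sum_le_sum fun i _ => (h3 i).2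
            _ = N := by simp
        refine ⟨⟨by linarith [h4.1], by linarith [h4.2]⟩, ?_⟩
        rw [mem_Icc, Pi.le_def, Pi.le_def]
        exact ⟨fun i => (h3 i).1, fun i => (h3 i).2⟩
      rw [this, norm_zero]

lemma convp_integrable (hk : Measurable k) (hb : ∀ x, ‖k x‖ ≤ 1) (h0 : ∀ x, x ∉ Icc (0:ℝ) 1 → k x = 0) :
    Integrable (convp k N) :=
  (convp_joint_integrable k N hk hb h0).integral_prod_left

lemma convp_fourier (hk : Measurable k) (hb : ∀ x, ‖k x‖ ≤ 1) (h0 : ∀ x, x ∉ Icc (0:ℝ) 1 → k x = 0)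
    (w : ℝ) : 𝓕 (convp k N) w = (𝓕 k w)^(N+1) := by
  rw [Real.fourier_real_eq_integral_exp_smul, Real.fourier_real_eq_integral_exp_smul]
  simp only [smul_eq_mul]
  set e : ℝ → ℂ := fun v => Complex.exp (((-2 * Real.pi * v * w : ℝ) : ℂ) * Complex.I) with he
  have he_add : ∀ u v, e (u + v) = e u * e v := fun u v => by
    simp only [he]; rw [← Complex.exp_add]; congr 1; push_cast; ring
  have he0 : e 0 = 1 := by simp [he]
  have he_sum : ∀ a : Fin N → ℝ, e (∑ i, a i) = ∏ i, e (a i) := fun a => by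
    simp only [he]
    rw [← Complex.exp_sum]; congr 1
    push_cast
    rw [Finset.mul_sum, Finset.sum_mul, Finset.sum_mul]
  have hem : Measurable e := by simp only [he]; fun_prop
  have hen : ∀ v, ‖e v‖ = 1 := fun v => by simp only [he]; rw [Complex.norm_exp_ofReal_mul_I]
  have hJ := convp_joint_integrable k N hk hb h0
  have hJ2 : Integrable (fun q : ℝ × (Fin N → ℝ) => e q.1 * ((∏ i, k (q.2 i)) * k (q.1 - ∑ i, q.2 i))) :=
    hJ.bdd_mul (c := 1) (hem.comp measurable_fst).aestronglyMeasurable (ae_of_all _ fun q => (hen _).le)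
  calc ∫ y, e y * convp k N y
      = ∫ y, ∫ a : Fin N → ℝ, e y * ((∏ i, k (a i)) * k (y - ∑ i, a i)) := by
        congr 1; ext y; rw [convp, integral_const_mul]
    _ = ∫ a : Fin N → ℝ, ∫ y, e y * ((∏ i, k (a i)) * k (y - ∑ i, a i)) :=
        integral_integral_swap hJ2
    _ = ∫ a : Fin N → ℝ, (∏ i, (e (a i) * k (a i))) * ∫ x, e x * k x := by
        congr 1; ext a
        rw [← integral_const_mul]
        rw [← integral_add_right_eq_self (fun y => e y * ((∏ i, k (a i)) * k (y - ∑ i, a i))) (∑ i, a i)]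
        congr 1; ext x
        rw [add_sub_cancel_right, he_add, he_sum, Finset.prod_mul_distrib]; ring
    _ = _ := by
        rw [integral_mul_const, integral_fintype_prod_volume_eq_pow (fun x => e x * k x)]
        rw [Fintype.card_fin, pow_succ]

lemma convp_continuousAt (hN : 0 < N) (hk : Measurable k) (hb : ∀ x, ‖k x‖ ≤ 1)
    (h0 : ∀ x, x ∉ Icc (0:ℝ) 1 → k x = 0) (D : Set ℝ) (hD : D.Countable)
    (hc : ∀ x, x ∉ D → ContinuousAt k x) (y : ℝ) : ContinuousAt (convp k N) y := by
  unfold convp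
  refine continuousAt_of_dominated (bound := (Icc (0 : Fin N → ℝ) 1).indicator (fun _ => (1:ℝ))) ?_ ?_ ?_ ?_
  · refine Filter.Eventually.of_forall fun x => Measurable.aestronglyMeasurable (Measurable.mul ?_ ?_)
    · exact Finset.measurable_prod _ fun i _ => hk.comp (measurable_pi_apply i)
    · exact hk.comp (by fun_prop)
  · refine Filter.Eventually.of_forall fun x => ae_of_all _ fun a => ?_
    by_cases ha : a ∈ Icc (0 : Fin N → ℝ) 1
    · rw [indicator_of_mem ha, norm_mul, norm_prod]
      have : ∏ i, ‖k (a i)‖ ≤ 1 := Finset.prod_le_one (fun _ _ => norm_nonneg _) fun i _ => hb _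
      exact mul_le_one₀ this (norm_nonneg _) (hb _)
    · rw [indicator_of_notMem ha]
      have : ∃ i, a i ∉ Icc (0:ℝ) 1 := by
        by_contra hcon
        push Not at hcon
        exact ha ⟨fun i => (hcon i).1, fun i => (hcon i).2⟩
      obtain ⟨i, hi⟩ := this
      rw [Finset.prod_eq_zero (Finset.mem_univ i) (h0 _ hi)]; simp
  · rw [integrable_indicator_iff measurableSet_Icc]
    exact integrableOn_const isCompact_Icc.measure_lt_top.ne
  · have : ∀ᵐ a : Fin N → ℝ, y - ∑ i, a i ∉ D := by
      rw [ae_iff]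
      have : {a : Fin N → ℝ | ¬ (y - ∑ i, a i ∉ D)} ⊆ ⋃ d ∈ D, {a | ∑ i, a i = y - d} := by
        intro a ha
        simp only [mem_ofPred_eq, not_not] at ha
        simp only [mem_iUnion, mem_ofPred_eq]
        exact ⟨_, ha, by ring⟩
      refine measure_mono_null this ?_
      rw [measure_biUnion_null_iff hD]
      intro d _
      exact hyperplane_null N hN _
    filter_upwards [this] with a ha
    refine ContinuousAt.mul continuousAt_const ?_
    exact ContinuousAt.comp (f := fun x => x - ∑ i, a i) (hc _ ha) (by fun_prop)

lemma convp_inversion (hN : 0 < N) (hk : Measurable k) (hb : ∀ x, ‖k x‖ ≤ 1)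
    (h0 : ∀ x, x ∉ Icc (0:ℝ) 1 → k x = 0) (D : Set ℝ) (hD : D.Countable)
    (hc : ∀ x, x ∉ D → ContinuousAt k x) (hF : Integrable (fun w => (𝓕 k w)^(N+1))) (y : ℝ) :
    convp k N y = ∫ w, Complex.exp (((2 * Real.pi * (w * y) : ℝ) : ℂ) * Complex.I) * (𝓕 k w)^(N+1) := by
  have hFe : 𝓕 (convp k N) = fun w => (𝓕 k w)^(N+1) := funext (convp_fourier k N hk hb h0)
  have h := (convp_integrable k N hk hb h0).fourierInv_fourier_eq (by rw [hFe]; exact hF)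
    (convp_continuousAt k N hN hk hb h0 D hD hc y)
  rw [← h, Real.fourierInv_eq', hFe]
  congr 1; ext w
  simp [mul_comm]
end conv

/-- the slice of the cube -/
def slice (N : ℕ) : Set (Fin N → ℝ) :=
  {a | (∀ i, a i ∈ Icc (0:ℝ) 1) ∧ (((N+1 : ℕ) : ℝ)/2 - ∑ i, a i) ∈ Icc (0:ℝ) 1}

lemma measurableSet_slice (N : ℕ) : MeasurableSet (slice N) := by
  have h1 : MeasurableSet {a : Fin N → ℝ | ∀ i, a i ∈ Icc (0:ℝ) 1} :=
    by
    have : {a : Fin N → ℝ | ∀ i, a i ∈ Icc (0:ℝ) 1} = ⋂ i, (fun a : Fin N → ℝ => a i) ⁻¹' Icc (0:ℝ) 1 := by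
      ext a; simp
    rw [this]
    exact MeasurableSet.iInter fun i => (measurable_pi_apply i) measurableSet_Icc
  have h2 : Measurable fun a : Fin N → ℝ => ((N+1 : ℕ) : ℝ)/2 - ∑ i, a i := by fun_prop
  exact h1.inter (h2 measurableSet_Icc)

/-- total score -/
noncomputable def score (N : ℕ) (g : ℝ → ℝ) (a : Fin N → ℝ) : ℝ :=
  ∑ i, g (a i) + g (((N+1 : ℕ) : ℝ)/2 - ∑ i, a i)

lemma Phi_pow_integrable (g : ℝ → ℝ) (hg : Measurable g) (s : ℝ) (n : ℕ) :
    Integrable (fun t => (Phi g s t)^(n+2)) := by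
  refine (Phi_L2 g hg s).1.mono' ((Phi_continuous g hg s).pow _).aestronglyMeasurable (ae_of_all _ fun t => ?_)
  rw [norm_pow, pow_add]
  exact mul_le_of_le_one_left (by positivity) (pow_le_one₀ (norm_nonneg _) (Phi_norm_le_one g s t))

lemma slice_fourier (N : ℕ) (hN : 0 < N) (g : ℝ → ℝ) (hg : Measurable g) (D : Set ℝ) (hD : D.Countable)
    (hc : ∀ x, x ∉ D → ContinuousAt g x) (s : ℝ) :
    ∫ a in slice N, Complex.exp (((s * score N g a : ℝ) : ℂ) * Complex.I)
      = (2 * Real.pi : ℂ)⁻¹ * ∫ t, (Phi g s t)^(N+1) := by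
  set k : ℝ → ℂ := (Icc (0:ℝ) 1).indicator (fun x => Complex.exp (((s * g x : ℝ) : ℂ) * Complex.I)) with hkdef
  have hk : Measurable k := Measurable.indicator (by fun_prop) measurableSet_Icc
  have hb : ∀ x, ‖k x‖ ≤ 1 := fun x => by
    simp only [hkdef, indicator_apply]
    split_ifs
    · rw [Complex.norm_exp_ofReal_mul_I]
    · simp
  have h0 : ∀ x, x ∉ Icc (0:ℝ) 1 → k x = 0 := fun x hx => indicator_of_notMem hx _
  have hck : ∀ x, x ∉ D ∪ {0, 1} → ContinuousAt k x := by
    intro x hx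
    simp only [mem_union, mem_insert_iff, mem_singleton_iff, not_or] at hx
    obtain ⟨hxD, hx0, hx1⟩ := hx
    by_cases hxi : x ∈ Ioo (0:ℝ) 1
    · have : ContinuousAt (fun x => Complex.exp (((s * g x : ℝ) : ℂ) * Complex.I)) x := by
        have := hc x hxD
        fun_prop
      refine this.congr ?_
      filter_upwards [isOpen_Ioo.mem_nhds hxi] with z hz
      rw [hkdef, indicator_of_mem (Ioo_subset_Icc_self hz)]
    · have hx2 : x ∉ Icc (0:ℝ) 1 := fun h => hxi ⟨lt_of_le_of_ne h.1 (Ne.symm hx0), lt_of_le_of_ne h.2 hx1⟩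
      have : ContinuousAt (fun _ : ℝ => (0:ℂ)) x := continuousAt_const
      refine this.congr ?_
      filter_upwards [isClosed_Icc.isOpen_compl.mem_nhds hx2] with z hz
      exact (h0 z hz).symm
  have hFk : ∀ w, 𝓕 k w = Complex.exp (-((Real.pi * w : ℝ) : ℂ) * Complex.I) * Phi g s (-2 * Real.pi * w) := by
    intro w
    rw [Real.fourier_real_eq_integral_exp_smul, Phi, ← integral_const_mul, ← integral_Icc_eq_integral_Ioc,
      ← integral_indicator measurableSet_Icc]
    congr 1; ext x
    simp only [hkdef, indicator_apply]
    split_ifs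
    · rw [smul_eq_mul, ← Complex.exp_add, ← Complex.exp_add]
      congr 1; push_cast; ring
    · simp
  have hpow : ∀ w, (𝓕 k w)^(N+1) = Complex.exp (-((Real.pi * w * (N+1) : ℝ) : ℂ) * Complex.I) * (Phi g s (-2 * Real.pi * w))^(N+1) := by
    intro w
    rw [hFk, mul_pow, ← Complex.exp_nat_mul]
    congr 2; push_cast; ring
  have hpi : (-2 * Real.pi) ≠ 0 := by have := Real.pi_pos; nlinarith
  obtain ⟨m, rfl⟩ : ∃ m, N = m + 1 := ⟨N - 1, by omega⟩
  have hPint := Phi_pow_integrable g hg s m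
  have hPint2 : Integrable (fun w => (Phi g s (-2 * Real.pi * w))^(m+1+1)) :=
    hPint.comp_mul_left' hpi
  have hF : Integrable (fun w => (𝓕 k w)^(m+1+1)) := by
    simp_rw [hpow]
    refine hPint2.bdd_mul (c := 1) (Continuous.aestronglyMeasurable (by fun_prop)) (ae_of_all _ fun w => ?_)
    rw [← Complex.ofReal_neg, Complex.norm_exp_ofReal_mul_I]
  have hinv := convp_inversion k (m+1) hN hk hb h0 _ (hD.union (by simp)) hck hF (((m+1+1 : ℕ) : ℝ)/2)
  have e1 : ∫ a in slice (m+1), Complex.exp (((s * score (m+1) g a : ℝ) : ℂ) * Complex.I)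
      = convp k (m+1) (((m+1+1 : ℕ) : ℝ)/2) := by
    rw [convp, ← integral_indicator (measurableSet_slice _)]
    congr 1; ext a
    by_cases ha : a ∈ slice (m+1)
    · rw [indicator_of_mem ha]
      have e2 : ∀ i, k (a i) = Complex.exp (((s * g (a i) : ℝ) : ℂ) * Complex.I) := fun i =>
        indicator_of_mem (ha.1 i) _
      have e3 : k (((m+1+1 : ℕ) : ℝ)/2 - ∑ i, a i) = _ := indicator_of_mem ha.2 _
      rw [e3]
      simp_rw [e2]
      rw [← Complex.exp_sum, ← Complex.exp_add, score]
      congr 1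
      push_cast
      rw [← Finset.sum_mul, ← Finset.mul_sum]; ring
    · rw [indicator_of_notMem ha]
      symm
      by_contra hne
      have h1 := left_ne_zero_of_mul hne
      have h2 := right_ne_zero_of_mul hne
      rw [Finset.prod_ne_zero_iff] at h1
      apply ha
      exact ⟨fun i => by by_contra hc; exact h1 i (Finset.mem_univ _) (h0 _ hc),
        by by_contra hc; exact h2 (h0 _ hc)⟩
  rw [e1, hinv]
  have e4 : ∀ w : ℝ, Complex.exp (((2 * Real.pi * (w * (((m+1+1 : ℕ) : ℝ)/2)) : ℝ) : ℂ) * Complex.I) * (𝓕 k w)^(m+1+1)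
      = (fun t => (Phi g s t)^(m+1+1)) (-2 * Real.pi * w) := by
    intro w
    rw [hpow, ← mul_assoc, ← Complex.exp_add]
    have : (((2 * Real.pi * (w * (((m+1+1 : ℕ) : ℝ)/2)) : ℝ) : ℂ) * Complex.I) + -((Real.pi * w * ((m+1:ℕ)+1) : ℝ) : ℂ) * Complex.I = 0 := by
      push_cast; ring
    rw [this, Complex.exp_zero, one_mul]
  rw [integral_congr_ae (ae_of_all _ e4), Measure.integral_comp_mul_left (fun t => (Phi g s t)^(m+1+1))]
  rw [Complex.real_smul]
  congr 1
  rw [abs_inv, abs_mul, abs_neg, abs_two, abs_of_pos Real.pi_pos]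
  push_cast; rfl

lemma Phi_zero_formula (f : ℝ → ℝ) (t : ℝ) (ht : t ≠ 0) :
    Phi f 0 t = ((Real.sin (t/2) / (t/2) : ℝ) : ℂ) := by
  rw [Phi, ← intervalIntegral.integral_of_le zero_le_one]
  have h : ∀ x : ℝ, Complex.exp (((0 * f x + t * (x - 1/2) : ℝ) : ℂ) * Complex.I)
      = Complex.exp (-(((t/2 : ℝ) : ℂ) * Complex.I)) * Complex.exp ((t * Complex.I) * x) := by
    intro x
    rw [← Complex.exp_add]; congr 1; push_cast; ring
  have hc : (t : ℂ) * Complex.I ≠ 0 := mul_ne_zero (by exact_mod_cast ht) Complex.I_ne_zero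
  have ht' : (t : ℂ) ≠ 0 := by exact_mod_cast ht
  simp_rw [h]
  rw [intervalIntegral.integral_const_mul, integral_exp_mul_complex hc, ← mul_div_assoc, mul_sub, ← Complex.exp_add, ← Complex.exp_add]
  push_cast
  rw [Complex.sin]
  have e1 : -((t : ℂ)/2 * Complex.I) + t * Complex.I * 1 = (t:ℂ)/2 * Complex.I := by ring
  have e2 : -((t : ℂ)/2 * Complex.I) + t * Complex.I * 0 = -(t:ℂ)/2 * Complex.I := by ring
  have e3 : -((t : ℂ)/2) * Complex.I = -(t:ℂ)/2 * Complex.I := by ring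
  rw [e1, e2, e3]
  field_simp
  ring_nf
  simp [Complex.I_sq]
  ring

lemma Phi_zero_zero (f : ℝ → ℝ) : Phi f 0 0 = 1 := by
  simp [Phi]

lemma Phi_zero_im (f : ℝ → ℝ) (t : ℝ) : (Phi f 0 t).im = 0 := by
  rcases eq_or_ne t 0 with rfl | ht
  · simp [Phi_zero_zero]
  · rw [Phi_zero_formula f t ht, Complex.ofReal_im]

lemma Phi_zero_re_ge (f : ℝ → ℝ) (t : ℝ) (ht : |t| ≤ 1) : 1 - t^2/16 ≤ (Phi f 0 t).re := by
  rcases eq_or_ne t 0 with rfl | h0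
  · simp [Phi_zero_zero]
  · rw [Phi_zero_formula f t h0, Complex.ofReal_re]
    have key : ∀ u : ℝ, 0 < u → u ≤ 1 → 1 - u^2/4 ≤ Real.sin u / u := by
      intro u hu hu1
      rw [le_div_iff₀ hu]
      have := Real.sin_gt_sub_cube hu
      nlinarith [pow_pos hu 3]
    rcases lt_or_gt_of_ne h0 with h | h
    · have := key (-(t/2)) (by linarith) (by rw [abs_of_neg h] at ht; linarith)
      rw [Real.sin_neg, neg_div_neg_eq] at this
      nlinarith
    · have := key (t/2) (by linarith) (by rw [abs_of_pos h] at ht; linarith)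
      nlinarith

instance : IsFiniteMeasure (volume.restrict (Ioc (0:ℝ) 1)) := by infer_instance

lemma unif_bdd_integrable (h : ℝ → ℝ) (hh : Measurable h) (M : ℝ) (hM : ∀ x ∈ Ioc (0:ℝ) 1, |h x| ≤ M) :
    Integrable h (volume.restrict (Ioc (0:ℝ) 1)) := by
  refine Integrable.of_bound hh.aestronglyMeasurable M ?_
  filter_upwards [ae_restrict_mem measurableSet_Ioc] with x hx
  exact hM x hx

lemma U_int : ∫ x in Ioc (0:ℝ) 1, (x - 1/2) = 0 := by
  rw [← intervalIntegral.integral_of_le zero_le_one, intervalIntegral.integral_sub (by simp) (by simp)]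
  simp

lemma U_sq_int : ∫ x in Ioc (0:ℝ) 1, (x - 1/2)^2 = 1/12 := by
  rw [← intervalIntegral.integral_of_le zero_le_one]
  have : ∀ x : ℝ, (x - 1/2)^2 = x^2 - x + 1/4 := fun x => by ring
  simp_rw [this]
  rw [intervalIntegral.integral_add (Continuous.intervalIntegrable (by fun_prop) _ _) (by simp),
    intervalIntegral.integral_sub (Continuous.intervalIntegrable (by fun_prop) _ _) (by simp)]
  simp; norm_num

section E
variable (f : ℝ → ℝ) (K V : ℝ)

lemma Phi_small (hf : Measurable f) (hK : ∀ x ∈ Ioc (0:ℝ) 1, |f x| ≤ K)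
    (h0 : ∫ x in Ioc (0:ℝ) 1, f x = 0) (h1 : ∫ x in Ioc (0:ℝ) 1, f x * (x - 1/2) = 0)
    (hV : V ≤ ∫ x in Ioc (0:ℝ) 1, f x ^ 2) (s t : ℝ) (hst : |s| * K + |t|/2 ≤ 1) :
    ‖Phi f s t‖ ≤ Real.exp (-(s^2*V + t^2/12)/5) := by
  have hU : ∀ x ∈ Ioc (0:ℝ) 1, |x - 1/2| ≤ 1/2 := fun x hx => abs_le.2 ⟨by linarith [hx.1], by linarith [hx.2]⟩
  have i1 : Integrable f (volume.restrict (Ioc (0:ℝ) 1)) := unif_bdd_integrable f hf K hK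
  have i2 : Integrable (fun x : ℝ => x - 1/2) (volume.restrict (Ioc (0:ℝ) 1)) :=
    unif_bdd_integrable _ (by fun_prop) (1/2) hU
  have i3 : Integrable (fun x : ℝ => f x ^ 2) (volume.restrict (Ioc (0:ℝ) 1)) :=
    unif_bdd_integrable _ (by fun_prop) (K^2) fun x hx => by
      rw [abs_pow]; exact pow_le_pow_left₀ (abs_nonneg _) (hK x hx) 2
  have i4 : Integrable (fun x : ℝ => f x * (x - 1/2)) (volume.restrict (Ioc (0:ℝ) 1)) :=
    unif_bdd_integrable _ (by fun_prop) (K * (1/2)) fun x hx => by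
      rw [abs_mul]; exact mul_le_mul (hK x hx) (hU x hx) (abs_nonneg _) ((abs_nonneg _).trans (hK x hx))
  have i5 : Integrable (fun x : ℝ => (x - 1/2)^2) (volume.restrict (Ioc (0:ℝ) 1)) :=
    unif_bdd_integrable _ (by fun_prop) ((1/2)^2) fun x hx => by
      rw [abs_pow]; exact pow_le_pow_left₀ (abs_nonneg _) (hU x hx) 2
  have hmean : ∫ x in Ioc (0:ℝ) 1, (s * f x + t * (x - 1/2)) = 0 := by
    rw [integral_add (i1.const_mul s) (i2.const_mul t), integral_const_mul, integral_const_mul, h0, U_int]; simp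
  have hvar : ∫ x in Ioc (0:ℝ) 1, (s * f x + t * (x - 1/2))^2 = s^2 * (∫ x in Ioc (0:ℝ) 1, f x ^ 2) + t^2/12 := by
    have e : ∀ x, (s * f x + t * (x - 1/2))^2 = s^2 * f x ^2 + (2*s*t) * (f x * (x-1/2)) + t^2 * (x-1/2)^2 := fun x => by ring
    simp_rw [e]
    have j : Integrable (fun x => s^2 * f x ^2 + (2*s*t) * (f x * (x-1/2))) (volume.restrict (Ioc (0:ℝ) 1)) :=
      (i3.const_mul _).add (i4.const_mul _)
    rw [integral_add j (i5.const_mul _),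
      integral_add (i3.const_mul _) (i4.const_mul _), integral_const_mul, integral_const_mul, integral_const_mul, h1, U_sq_int]
    ring
  have hm : AEMeasurable (fun x => s * f x + t * (x - 1/2)) (volume.restrict (Ioc (0:ℝ) 1)) :=
    Measurable.aemeasurable (by fun_prop)
  have hb : ∀ᵐ x ∂(volume.restrict (Ioc (0:ℝ) 1)), |s * f x + t * (x - 1/2)| ≤ 1 := by
    filter_upwards [ae_restrict_mem measurableSet_Ioc] with x hx
    calc |s * f x + t * (x - 1/2)| ≤ |s| * |f x| + |t| * |x - 1/2| := by
          rw [← abs_mul, ← abs_mul]; exact abs_add_le _ _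
      _ ≤ |s| * K + |t| * (1/2) := by gcongr; exacts [hK x hx, hU x hx]
      _ ≤ 1 := by linarith
  have := norm_charint_le (volume.restrict (Ioc (0:ℝ) 1)) _ hm hb hmean
  refine this.trans (Real.exp_le_exp.2 ?_)
  rw [hvar]
  have : s^2 * V ≤ s^2 * ∫ x in Ioc (0:ℝ) 1, f x ^ 2 := by gcongr
  linarith

lemma Phi_zero_large (t : ℝ) (ht : 1 ≤ |t|) : ‖Phi f 0 t‖ ≤ 0.985 := by
  have key : ∀ t : ℝ, 1 ≤ |t| → |t| ≤ 2 → ‖Phi f 0 t‖ ≤ 0.985 := by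
    intro t h1 h2
    have e : Phi f 0 t = Phi (fun _ => 0) 0 t := by simp [Phi]
    have := Phi_small (fun _ => 0) 0 0 measurable_const (by simp) (by simp) (by simp) (by simp) 0 t (by simp; linarith)
    rw [e]
    refine this.trans ?_
    have ht2 : 1 ≤ t^2 := by rw [← sq_abs]; nlinarith
    calc _ ≤ Real.exp (-(1/60)) := Real.exp_le_exp.2 (by linarith)
      _ = (Real.exp (1/60))⁻¹ := Real.exp_neg _
      _ ≤ (1/60+1)⁻¹ := inv_anti₀ (by norm_num) (Real.add_one_le_exp _)
      _ ≤ _ := by norm_num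
  have ht0 : t ≠ 0 := by rintro rfl; simp at ht; linarith
  rcases le_total |t| 2 with h | h
  · exact key t ht h
  rcases le_total |t| 4 with h4 | h4
  · have h2 : |t/2| = |t|/2 := by rw [abs_div]; norm_num
    have := key (t/2) (by rw [h2]; linarith) (by rw [h2]; linarith)
    refine le_trans ?_ this
    rw [Phi_zero_formula f t ht0, Phi_zero_formula f (t/2) (by simpa using ht0), Complex.norm_real, Complex.norm_real]
    have : Real.sin (t/2) / (t/2) = Real.sin (t/2/2) / (t/2/2) * Real.cos (t/2/2) := by
      conv_lhs => rw [show t/2 = 2 * (t/2/2) by ring, Real.sin_two_mul]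
      field_simp
    rw [this, norm_mul]
    exact mul_le_of_le_one_right (norm_nonneg _) (by rw [Real.norm_eq_abs]; exact Real.abs_cos_le_one _)
  · rw [Phi_zero_formula f t ht0, Complex.norm_real, Real.norm_eq_abs, abs_div, abs_div, div_le_iff₀ (by positivity)]
    have := Real.abs_sin_le_one (t/2)
    rw [abs_of_pos (show (0:ℝ) < 2 by norm_num)]
    nlinarith

lemma cexp_int_integrable (h : ℝ → ℝ) (hh : Measurable h) :
    Integrable (fun x => Complex.exp ((h x : ℂ) * Complex.I)) (volume.restrict (Ioc (0:ℝ) 1)) := by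
  refine Integrable.of_bound (Measurable.aestronglyMeasurable (by fun_prop)) 1 (ae_of_all _ fun x => ?_)
  rw [Complex.norm_exp_ofReal_mul_I]

lemma Phi_sub_zero (hf : Measurable f) (hK : ∀ x ∈ Ioc (0:ℝ) 1, |f x| ≤ K) (s t : ℝ) :
    ‖Phi f s t - Phi f 0 t‖ ≤ |s| * K := by
  rw [Phi, Phi, ← integral_sub (cexp_int_integrable _ (by fun_prop)) (cexp_int_integrable _ (by fun_prop))]
  have : ∀ᵐ x ∂(volume.restrict (Ioc (0:ℝ) 1)), ‖Complex.exp (((s * f x + t * (x - 1/2) : ℝ) : ℂ) * Complex.I) -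
      Complex.exp (((0 * f x + t * (x - 1/2) : ℝ) : ℂ) * Complex.I)‖ ≤ |s| * K := by
    filter_upwards [ae_restrict_mem measurableSet_Ioc] with x hx
    have e : Complex.exp (((s * f x + t * (x - 1/2) : ℝ) : ℂ) * Complex.I) -
      Complex.exp (((0 * f x + t * (x - 1/2) : ℝ) : ℂ) * Complex.I) = 
      Complex.exp (((0 * f x + t * (x - 1/2) : ℝ) : ℂ) * Complex.I) * (Complex.exp (Complex.I * ((s * f x : ℝ) : ℂ)) - 1) := by
      rw [mul_sub (Complex.exp _), ← Complex.exp_add, mul_one]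
      congr 2; push_cast; ring
    rw [e, norm_mul, Complex.norm_exp_ofReal_mul_I, one_mul]
    refine (Real.norm_exp_I_mul_ofReal_sub_one_le).trans ?_
    rw [Real.norm_eq_abs, abs_mul]
    exact mul_le_mul_of_nonneg_left (hK x hx) (abs_nonneg _)
  have := norm_integral_le_of_norm_le_const this
  simpa using this

lemma Phi_large (hf : Measurable f) (hK : ∀ x ∈ Ioc (0:ℝ) 1, |f x| ≤ K) (s t : ℝ) (hs : |s| * K ≤ 1/100)
    (ht : 1 ≤ |t|) : ‖Phi f s t‖ ≤ 0.995 := by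
  have h1 := Phi_sub_zero f K hf hK s t
  have h2 := Phi_zero_large f t ht
  have : ‖Phi f s t‖ ≤ ‖Phi f s t - Phi f 0 t‖ + ‖Phi f 0 t‖ := by
    simpa using norm_add_le (Phi f s t - Phi f 0 t) (Phi f 0 t)
  norm_num at *; linarith

lemma Phi_im_le (hf : Measurable f) (hK : ∀ x ∈ Ioc (0:ℝ) 1, |f x| ≤ K) (s t : ℝ) :
    |(Phi f s t).im| ≤ |s| * K := by
  have h := Phi_sub_zero f K hf hK s t
  have h2 := (Complex.abs_im_le_norm _).trans h
  rwa [Complex.sub_im, Phi_zero_im, sub_zero] at h2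

lemma Phi_im_eq (hf : Measurable f) (s t : ℝ) : (Phi f s t).im = ∫ x in Ioc (0:ℝ) 1, Real.sin (s * f x + t * (x-1/2)) := by
  have := integral_im (𝕜 := ℂ) (cexp_int_integrable (fun x => s * f x + t * (x-1/2)) (by fun_prop))
  rw [Phi]
  refine Eq.trans this.symm ?_
  congr 1; ext x
  exact Complex.exp_ofReal_mul_I_im _

lemma sin_sub_lip (a b M : ℝ) (ha : |a| ≤ M) (hb : |b| ≤ M) :
    |(Real.sin a - a) - (Real.sin b - b)| ≤ M^2/2 * |a - b| := by
  have hd : ∀ x ∈ Icc (-M) M, HasDerivWithinAt (fun x => Real.sin x - x) (Real.cos x - 1) (Icc (-M) M) x :=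
    fun x _ => ((Real.hasDerivAt_sin x).sub (hasDerivAt_id x)).hasDerivWithinAt
  have hbd : ∀ x ∈ Icc (-M) M, ‖Real.cos x - 1‖ ≤ M^2/2 := by
    intro x hx
    rw [Real.norm_eq_abs, abs_sub_comm, abs_of_nonneg (by linarith [Real.cos_le_one x])]
    have := Real.one_sub_sq_div_two_le_cos (x := x)
    have : x^2 ≤ M^2 := sq_le_sq' hx.1 hx.2
    linarith
  have := (convex_Icc (-M) M).norm_image_sub_le_of_norm_hasDerivWithin_le hd hbd (abs_le.1 hb) (abs_le.1 ha)
  simpa only [Real.norm_eq_abs] using this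

lemma Phi_im_le2 (hf : Measurable f) (hK : ∀ x ∈ Ioc (0:ℝ) 1, |f x| ≤ K) 
    (h0 : ∫ x in Ioc (0:ℝ) 1, f x = 0) (s t : ℝ) :
    |(Phi f s t).im| ≤ |s| * K * (s^2*K^2 + t^2) := by
  have i1 : Integrable f (volume.restrict (Ioc (0:ℝ) 1)) := unif_bdd_integrable f hf K hK
  have hU : ∀ x ∈ Ioc (0:ℝ) 1, |x - 1/2| ≤ 1/2 := fun x hx => abs_le.2 ⟨by linarith [hx.1], by linarith [hx.2]⟩
  have is : ∀ h : ℝ → ℝ, Measurable h → Integrable (fun x => Real.sin (h x)) (volume.restrict (Ioc (0:ℝ) 1)) :=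
    fun h hh => unif_bdd_integrable _ (by fun_prop) 1 fun x _ => Real.abs_sin_le_one _
  have hz := Phi_zero_im f t
  rw [Phi_im_eq f hf] at hz
  have e : (Phi f s t).im = ∫ x in Ioc (0:ℝ) 1, (Real.sin (s * f x + t * (x-1/2)) - Real.sin (0 * f x + t * (x-1/2)) - s * f x) := by
    have j1 := is (fun x => s * f x + t * (x-1/2)) (by fun_prop)
    have j2 := is (fun x => 0 * f x + t * (x-1/2)) (by fun_prop)
    have j3 : Integrable (fun x => Real.sin (s * f x + t * (x-1/2)) - Real.sin (0 * f x + t * (x-1/2))) (volume.restrict (Ioc (0:ℝ) 1)) := j1.sub j2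
    rw [integral_sub j3 (i1.const_mul s), integral_sub j1 j2,
      hz, integral_const_mul, h0, Phi_im_eq f hf]; simp
  rw [e]
  have hb : ∀ᵐ x ∂(volume.restrict (Ioc (0:ℝ) 1)), 
      ‖(Real.sin (s * f x + t * (x-1/2)) - Real.sin (0 * f x + t * (x-1/2)) - s * f x)‖ ≤ |s| * K * (s^2*K^2 + t^2) := by
    filter_upwards [ae_restrict_mem measurableSet_Ioc] with x hx
    have a1 : |t * (x - 1/2)| ≤ |t| := by
      rw [abs_mul]; nlinarith [hU x hx, abs_nonneg t]
    have a2 : |s * f x| ≤ |s| * K := by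
      rw [abs_mul]; exact mul_le_mul_of_nonneg_left (hK x hx) (abs_nonneg _)
    have := sin_sub_lip (s * f x + t * (x-1/2)) (0 * f x + t * (x-1/2)) (|s| * K + |t|)
      ((abs_add_le _ _).trans (add_le_add a2 a1)) (by rw [zero_mul, zero_add]; linarith [abs_nonneg (s * f x)])
    rw [Real.norm_eq_abs]
    have e1 : (Real.sin (s * f x + t * (x-1/2)) - (s * f x + t * (x-1/2))) - (Real.sin (0 * f x + t * (x-1/2)) - (0 * f x + t * (x-1/2)))
      = Real.sin (s * f x + t * (x-1/2)) - Real.sin (0 * f x + t * (x-1/2)) - s * f x := by ring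
    have e2 : (s * f x + t * (x-1/2)) - (0 * f x + t * (x-1/2)) = s * f x := by ring
    rw [e1, e2] at this
    refine this.trans ?_
    have h3 : (|s| * K + |t|)^2/2 ≤ s^2*K^2 + t^2 := by
      rw [← sq_abs s, ← sq_abs t]; nlinarith [sq_nonneg (|s| * K - |t|)]
    calc _ ≤ (s^2*K^2 + t^2) * (|s| * K) := by gcongr
      _ = _ := by ring
  have := norm_integral_le_of_norm_le_const hb
  simpa using this

end E

section F
variable (f : ℝ → ℝ) (K V : ℝ)

lemma gauss_integrable' (b : ℝ) (hb : 0 < b) : Integrable (fun t : ℝ => Real.exp (-b * t^2)) :=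
  integrable_exp_neg_mul_sq hb

lemma Phi_pow_bound (hf : Measurable f) (hK : ∀ x ∈ Ioc (0:ℝ) 1, |f x| ≤ K)
    (h0 : ∫ x in Ioc (0:ℝ) 1, f x = 0) (h1 : ∫ x in Ioc (0:ℝ) 1, f x * (x - 1/2) = 0)
    (hV : V ≤ ∫ x in Ioc (0:ℝ) 1, f x ^ 2) (hV0 : 0 ≤ V) (s t : ℝ) (hs : |s| * K ≤ 1/100) (l : ℕ) :
    ‖Phi f s t‖^(l+2) ≤ (if |t| ≤ 1 then Real.exp (-(((l:ℝ)+3)*V/10) * s^2) * Real.exp (-(((l:ℝ)+3)/120) * t^2) else 0)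
       + (if |t| ≤ 1 then 0 else 0.995^l * ‖Phi f s t‖^2) := by
  split_ifs with h
  · have := Phi_small f K V hf hK h0 h1 hV s t (by linarith)
    rw [add_zero]
    calc ‖Phi f s t‖^(l+2) ≤ (Real.exp (-(s^2*V + t^2/12)/5))^(l+2) := pow_le_pow_left₀ (norm_nonneg _) this _
      _ = Real.exp ((l+2:ℕ) * (-(s^2*V + t^2/12)/5)) := by rw [Real.exp_nat_mul]
      _ ≤ _ := by
        rw [← Real.exp_add]
        apply Real.exp_le_exp.2
        push_cast
        have a1 : 0 ≤ s^2*V := by positivity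
        have a2 : 0 ≤ t^2 := by positivity
        have hl : (0:ℝ) ≤ l := by positivity
        nlinarith [mul_nonneg hl a1, mul_nonneg hl a2]
  · have := Phi_large f K hf hK s t hs (le_of_lt (not_le.1 h))
    rw [zero_add, pow_add]
    gcongr

lemma Phi_normpow_int (hf : Measurable f) (hK : ∀ x ∈ Ioc (0:ℝ) 1, |f x| ≤ K)
    (h0 : ∫ x in Ioc (0:ℝ) 1, f x = 0) (h1 : ∫ x in Ioc (0:ℝ) 1, f x * (x - 1/2) = 0)
    (hV : V ≤ ∫ x in Ioc (0:ℝ) 1, f x ^ 2) (hV0 : 0 ≤ V) (s : ℝ) (hs : |s| * K ≤ 1/100) (l : ℕ) :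
    ‖∫ t, (Phi f s t)^(l+3)‖ ≤ Real.exp (-(((l:ℝ)+3)*V/10) * s^2) * √(Real.pi / (((l:ℝ)+3)/120)) + 0.995^l * (2 * Real.pi) := by
  have hb : 0 < (((l:ℝ)+3)/120) := by positivity
  obtain ⟨hi, hle⟩ := Phi_L2 f hf s
  have hIntg : Integrable (fun t : ℝ => Real.exp (-(((l:ℝ)+3)*V/10) * s^2) * Real.exp (-(((l:ℝ)+3)/120) * t^2) + 0.995^l * ‖Phi f s t‖^2) :=
    ((gauss_integrable' _ hb).const_mul _).add (hi.const_mul _)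
  have hpt : ∀ t, ‖(Phi f s t)^(l+3)‖ ≤ Real.exp (-(((l:ℝ)+3)*V/10) * s^2) * Real.exp (-(((l:ℝ)+3)/120) * t^2) + 0.995^l * ‖Phi f s t‖^2 := by
    intro t
    have h := Phi_pow_bound f K V hf hK h0 h1 hV hV0 s t hs l
    rw [norm_pow, show l + 3 = (l+2) + 1 by ring, pow_succ]
    have h2 : ‖Phi f s t‖^(l+2) * ‖Phi f s t‖ ≤ ‖Phi f s t‖^(l+2) := mul_le_of_le_one_right (by positivity) (Phi_norm_le_one f s t)
    have e1 : 0 ≤ Real.exp (-(((l:ℝ)+3)*V/10) * s^2) * Real.exp (-(((l:ℝ)+3)/120) * t^2) := by positivity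
    have e2 : 0 ≤ 0.995^l * ‖Phi f s t‖^2 := by positivity
    split_ifs at h <;> linarith
  refine (norm_integral_le_of_norm_le hIntg (ae_of_all _ hpt)).trans ?_
  rw [integral_add ((gauss_integrable' _ hb).const_mul _) (hi.const_mul _), integral_const_mul, integral_const_mul, integral_gaussian]
  gcongr

lemma xexp_le (x : ℝ) : x * Real.exp (-x) ≤ Real.exp (-x/2) := by
  have h := Real.add_one_le_exp (x/2)
  have h2 : (1 + x/2 + (x/2)) ≤ Real.exp (x/2) * 2 := by linarith
  have h3 : x ≤ Real.exp (x/2) := by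
    have := Real.add_one_le_exp (x/2 - 1)
    have e : Real.exp (x/2) = Real.exp (x/2-1) * Real.exp 1 := by rw [← Real.exp_add]; congr 1; ring
    have e2 := Real.add_one_le_exp 1
    have := Real.exp_pos (x/2-1)
    rw [e]; nlinarith
  calc x * Real.exp (-x) ≤ Real.exp (x/2) * Real.exp (-x) := by gcongr
    _ = _ := by rw [← Real.exp_add]; congr 1; ring

lemma sq_exp_le (b x : ℝ) (hb : 0 < b) : x^2 * Real.exp (-b * x^2) ≤ (1/b) * Real.exp (-(b/2) * x^2) := by
  have := xexp_le (b * x^2)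
  have e1 : -(b*x^2)/2 = -(b/2) * x^2 := by ring
  have e2 : -(b*x^2) = -b*x^2 := by ring
  rw [e1, e2] at this
  rw [one_div, ← div_eq_inv_mul, le_div_iff₀ hb]; linarith

lemma Phi_im_int (hf : Measurable f) (hK : ∀ x ∈ Ioc (0:ℝ) 1, |f x| ≤ K) (hK0 : 0 ≤ K)
    (h0 : ∫ x in Ioc (0:ℝ) 1, f x = 0) (h1 : ∫ x in Ioc (0:ℝ) 1, f x * (x - 1/2) = 0)
    (hV : V ≤ ∫ x in Ioc (0:ℝ) 1, f x ^ 2) (hV0 : 0 < V) (s : ℝ) (hs : |s| * K ≤ 1/100) (l : ℕ)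
    (α β : ℝ) (hα : α = ((l:ℝ)+3)*V/10) (hβ : β = ((l:ℝ)+3)/120) :
    |(∫ t, (Phi f s t)^(l+3)).im| ≤ |s| * (((l:ℝ)+3) * K * ((K^2/α + 1/β) * √(Real.pi / (β/2)) * Real.exp (-(α/2) * s^2)
      + 0.995^l * (2 * Real.pi))) := by
  have hb : 0 < β := by rw [hβ]; positivity
  have ha : 0 < α := by rw [hα]; positivity
  obtain ⟨hi, hle⟩ := Phi_L2 f hf s
  have him : (∫ t, (Phi f s t)^(l+3)).im = ∫ t, ((Phi f s t)^(l+3)).im :=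
    (integral_im (𝕜 := ℂ) (Phi_pow_integrable f hf s (l+1))).symm
  rw [him]
  have hi2 := gauss_integrable' (β/2) (by positivity)
  have hIntg : Integrable (fun t : ℝ => (|s| * (((l:ℝ)+3) * K)) * (((K^2/α + 1/β) * Real.exp (-(α/2) * s^2)) * Real.exp (-(β/2) * t^2)
      + 0.995^l * ‖Phi f s t‖^2)) :=
    ((hi2.const_mul _).add (hi.const_mul _)).const_mul _
  have hpt : ∀ t, ‖((Phi f s t)^(l+3)).im‖ ≤ (|s| * (((l:ℝ)+3) * K)) * (((K^2/α + 1/β) * Real.exp (-(α/2) * s^2)) * Real.exp (-(β/2) * t^2)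
      + 0.995^l * ‖Phi f s t‖^2) := by
    intro t
    have h := Phi_pow_bound f K V hf hK h0 h1 hV hV0.le s t hs l
    rw [← hα, ← hβ] at h
    have hz := abs_im_pow_le (Phi f s t) (l+2)
    push_cast at hz
    rw [Real.norm_eq_abs]
    refine hz.trans ?_
    rw [show (l:ℝ)+2+1 = l+3 by ring]
    have e2 : 0 ≤ 0.995^l * ‖Phi f s t‖^2 := by positivity
    have e1 : 0 ≤ ((K^2/α + 1/β) * Real.exp (-(α/2) * s^2)) * Real.exp (-(β/2) * t^2) := by positivity
    suffices hh : ‖Phi f s t‖^(l+2) * |(Phi f s t).im| ≤ |s| * K * (((K^2/α + 1/β) * Real.exp (-(α/2) * s^2)) * Real.exp (-(β/2) * t^2)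
      + 0.995^l * ‖Phi f s t‖^2) by
      calc _ = ((l:ℝ)+3) * (‖Phi f s t‖^(l+2) * |(Phi f s t).im|) := by ring
        _ ≤ ((l:ℝ)+3) * (|s| * K * (((K^2/α + 1/β) * Real.exp (-(α/2) * s^2)) * Real.exp (-(β/2) * t^2)
      + 0.995^l * ‖Phi f s t‖^2)) := by gcongr
        _ = _ := by ring
    split_ifs at h with ht
    · rw [add_zero] at h
      have him2 := Phi_im_le2 f K hf hK h0 s t
      have s1 := sq_exp_le α s ha
      have s2 := sq_exp_le β t hb
      have m1 : Real.exp (-α * s^2) ≤ Real.exp (-(α/2) * s^2) := Real.exp_le_exp.2 (by nlinarith [sq_nonneg s])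
      have m2 : Real.exp (-β * t^2) ≤ Real.exp (-(β/2) * t^2) := Real.exp_le_exp.2 (by nlinarith [sq_nonneg t])
      calc _ ≤ (Real.exp (-α * s^2) * Real.exp (-β * t^2)) * (|s| * K * (s^2*K^2 + t^2)) := by gcongr
        _ = |s| * K * (K^2 * (s^2 * Real.exp (-α * s^2)) * Real.exp (-β * t^2) + Real.exp (-α * s^2) * (t^2 * Real.exp (-β * t^2))) := by ring
        _ ≤ |s| * K * (K^2 * ((1/α) * Real.exp (-(α/2) * s^2)) * Real.exp (-(β/2) * t^2) + Real.exp (-(α/2) * s^2) * ((1/β) * Real.exp (-(β/2) * t^2))) := by gcongr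
        _ = |s| * K * (((K^2/α + 1/β) * Real.exp (-(α/2) * s^2)) * Real.exp (-(β/2) * t^2) + 0) := by ring
        _ ≤ _ := by gcongr
    · rw [zero_add] at h
      have him2 := Phi_im_le f K hf hK s t
      calc _ ≤ (0.995^l * ‖Phi f s t‖^2) * (|s| * K) := by gcongr
        _ = |s| * K * (0 + 0.995^l * ‖Phi f s t‖^2) := by ring
        _ ≤ _ := by gcongr
  rw [← Real.norm_eq_abs]
  refine (norm_integral_le_of_norm_le hIntg (ae_of_all _ hpt)).trans ?_
  rw [integral_const_mul, integral_add (hi2.const_mul _) (hi.const_mul _), integral_const_mul, integral_const_mul, integral_gaussian, mul_assoc |s|]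
  have : (K ^ 2 / α + 1 / β) * Real.exp (-(α / 2) * s ^ 2) * √(Real.pi / (β / 2)) + 0.995 ^ l * ∫ (a : ℝ), ‖Phi f s a‖ ^ 2 ≤
     (K^2/α + 1/β) * √(Real.pi / (β/2)) * Real.exp (-(α/2) * s^2) + 0.995^l * (2 * Real.pi) := by
    have : (0.995:ℝ) ^ l * ∫ (a : ℝ), ‖Phi f s a‖ ^ 2 ≤ 0.995^l * (2 * Real.pi) := by gcongr
    linarith
  gcongr

lemma J0_ge (hf : Measurable f) (l : ℕ) (hq : 0.995^l * √((l:ℝ)+3) ≤ 1/8) :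
    1 / √((l:ℝ)+3) ≤ (∫ t, (Phi f 0 t)^(l+3)).re := by
  set r := √((l:ℝ)+3) with hr
  have hr0 : 0 < r := by positivity
  have hr2 : r^2 = l+3 := Real.sq_sqrt (by positivity)
  have hr1 : 1 ≤ r := by rw [hr]; apply Real.one_le_sqrt.2; linarith [show (0:ℝ) ≤ l by positivity]
  have hir : 1/r ≤ 1 := by rw [div_le_one hr0]; exact hr1
  have hre : (∫ t, (Phi f 0 t)^(l+3)).re = ∫ t, ((Phi f 0 t)^(l+3)).re :=
    (integral_re (𝕜 := ℂ) (Phi_pow_integrable f hf 0 (l+1))).symm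
  rw [hre]
  obtain ⟨hi, hle⟩ := Phi_L2 f hf 0
  have hind : Integrable (fun t : ℝ => (Icc (-(1/r)) (1/r)).indicator (fun _ => (15/16:ℝ)) t) :=
    (integrable_indicator_iff measurableSet_Icc).2 (by simp)
  have hpt : ∀ t, (Icc (-(1/r)) (1/r)).indicator (fun _ => (15/16:ℝ)) t - 0.995^l * ‖Phi f 0 t‖^2 ≤ ((Phi f 0 t)^(l+3)).re := by
    intro t
    have hP : Phi f 0 t = (((Phi f 0 t).re : ℝ) : ℂ) := Complex.ext (by simp) (by simp [Phi_zero_im])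
    set h := (Phi f 0 t).re with hh
    have hp : ((Phi f 0 t)^(l+3)).re = h^(l+3) := by
      rw [hP, ← Complex.ofReal_pow, Complex.ofReal_re]
    rw [hp]
    have e2 : 0 ≤ 0.995^l * ‖Phi f 0 t‖^2 := by positivity
    rcases le_or_gt |t| 1 with ht | ht
    · have hge := Phi_zero_re_ge f t ht
      have ht2 : t^2 ≤ 1 := by rw [← sq_abs]; nlinarith [abs_nonneg t]
      have hpos : 0 ≤ h := by linarith
      have : (Icc (-(1/r)) (1/r)).indicator (fun _ => (15/16:ℝ)) t ≤ h^(l+3) := by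
        rw [indicator_apply]
        split_ifs with hm
        · have ht3 : t^2 ≤ 1/((l:ℝ)+3) := by
            have := sq_le_sq' hm.1 hm.2
            rwa [div_pow, hr2, one_pow] at this
          have hB := one_add_mul_le_pow (a := -(1/((l:ℝ)+3)/16)) (by
            have : 1/((l:ℝ)+3) ≤ 1 := by rw [div_le_one (by positivity)]; linarith [show (0:ℝ) ≤ l by positivity]
            linarith) (l+3)
          have e : 1 + ((l+3:ℕ):ℝ) * (-(1/((l:ℝ)+3)/16)) = 15/16 := by push_cast; field_simp; norm_num
          rw [e] at hB
          refine hB.trans (pow_le_pow_left₀ ?_ (by linarith) _)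
          have : 1/((l:ℝ)+3) ≤ 1 := by rw [div_le_one (by positivity)]; linarith [show (0:ℝ) ≤ l by positivity]
          linarith
        · positivity
      linarith
    · rw [indicator_of_notMem (by
        intro hm
        have : |t| ≤ 1/r := abs_le.2 hm
        linarith)]
      have hl := Phi_zero_large f t ht.le
      have hn : ‖Phi f 0 t‖ = |h| := by rw [hP, Complex.norm_real, Real.norm_eq_abs]
      rw [hn] at hl ⊢
      have : |h^(l+3)| ≤ 0.995^l * |h|^2 := by
        rw [abs_pow, show l+3 = l+2+1 by ring, pow_succ, pow_add]
        have a1 : |h|^l ≤ 0.995^l := pow_le_pow_left₀ (abs_nonneg _) (by norm_num at *; linarith) _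
        have a2 : |h| ≤ 1 := by norm_num at *; linarith
        calc |h|^l * |h|^2 * |h| ≤ 0.995^l * |h|^2 * 1 := by gcongr
          _ = _ := by ring
      linarith [neg_abs_le (h^(l+3))]
  have hmono := integral_mono (hind.sub (hi.const_mul (0.995^l))) (Phi_pow_integrable f hf 0 (l+1)).re hpt
  refine le_trans ?_ hmono
  simp only [Pi.sub_apply]
  rw [integral_sub hind (hi.const_mul _), integral_indicator measurableSet_Icc, integral_const_mul]
  have hv : (volume.restrict (Icc (-(1/r)) (1/r))).real univ = 2/r := by
    simp only [Measure.real, Measure.restrict_apply_univ, Real.volume_Icc]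
    rw [ENNReal.toReal_ofReal (by rw [sub_neg_eq_add]; positivity)]; ring
  rw [integral_const, hv, smul_eq_mul]
  have hpi := Real.pi_lt_d2
  have hq' : 0.995^l ≤ 1/8 * (1/r) := by
    rw [mul_one_div, le_div_iff₀ hr0]; exact hq
  have hq0 : (0:ℝ) ≤ 0.995^l := by positivity
  have a1 : (0.995:ℝ) ^ l * ∫ (a : ℝ), ‖Phi f 0 a‖ ^ 2 ≤ 0.995^l * (2 * Real.pi) := by gcongr
  have a2 : (0.995:ℝ) ^ l * (2 * Real.pi) ≤ 1/8*(1/r) * 6.3 := mul_le_mul hq' (by linarith) (by positivity) (by positivity)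
  have : 2/r*(15/16) = 15/8 * (1/r) := by ring
  rw [this]
  have : 0 < 1/r := by positivity
  nlinarith
end F

lemma slice_finite (N : ℕ) : volume (slice N) ≠ ⊤ := by
  refine ne_top_of_le_ne_top ?_ (measure_mono (t := Icc (0 : Fin N → ℝ) 1) ?_)
  · exact (isCompact_Icc).measure_lt_top.ne
  · intro a ha
    exact ⟨fun i => (ha.1 i).1, fun i => (ha.1 i).2⟩

lemma slice_vol_ge (l : ℕ) (hq : 0.995^l * √((l:ℝ)+3) ≤ 1/8) :
    (2 * Real.pi)⁻¹ * (1 / √((l:ℝ)+3)) ≤ volume.real (slice (l+2)) := by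
  have h := slice_fourier (l+2) (by omega) (fun _ => 0) measurable_const ∅ (by simp) (fun _ _ => continuousAt_const) 0
  have h2 := J0_ge (fun _ => 0) measurable_const l hq
  have h3 : ∫ a in slice (l+2), Complex.exp (((0 * score (l+2) (fun _ => 0) a : ℝ) : ℂ) * Complex.I) = ((volume.real (slice (l+2)) : ℝ) : ℂ) := by
    simp
  rw [h3] at h
  have h4 := congrArg Complex.re h
  rw [Complex.ofReal_re] at h4
  rw [h4]
  have : ((2:ℂ) * Real.pi)⁻¹ = (((2 * Real.pi)⁻¹ : ℝ) : ℂ) := by push_cast; rfl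
  rw [this, Complex.re_ofReal_mul]
  gcongr

lemma slice_vol_pos (l : ℕ) (hq : 0.995^l * √((l:ℝ)+3) ≤ 1/8) : 0 < volume.real (slice (l+2)) :=
  lt_of_lt_of_le (by positivity) (slice_vol_ge l hq)

lemma slice_prob (l : ℕ) (hq : 0.995^l * √((l:ℝ)+3) ≤ 1/8) : IsProbabilityMeasure (cond volume (slice (l+2))) := by
  have := slice_vol_pos l hq
  refine cond_isProbabilityMeasure_of_finite ?_ (slice_finite _)
  intro h
  rw [Measure.real, h] at this; simp at this

lemma cond_integral (N : ℕ) (h : (Fin N → ℝ) → ℂ) :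
    ∫ a, h a ∂(cond volume (slice N)) = (((volume.real (slice N))⁻¹ : ℝ) : ℂ) * ∫ a in slice N, h a := by
  rw [ProbabilityTheory.cond, integral_smul_measure, ENNReal.toReal_inv]
  rfl

lemma score_measurable (N : ℕ) (f : ℝ → ℝ) (hf : Measurable f) : Measurable (score N f) := by
  unfold score; fun_prop

section G
variable (f : ℝ → ℝ) (K V : ℝ)

lemma cond_char (l : ℕ) (hf : Measurable f) (D : Set ℝ) (hD : D.Countable)
    (hc : ∀ x, x ∉ D → ContinuousAt f x) (s : ℝ) (hq : 0.995^l * √((l:ℝ)+3) ≤ 1/8) :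
    ∃ κ : ℝ, 0 ≤ κ ∧ κ ≤ √((l:ℝ)+3) ∧
    ∫ a, Complex.exp (((s * score (l+2) f a : ℝ) : ℂ) * Complex.I) ∂(cond volume (slice (l+2))) = 
     (κ : ℂ) * ∫ t, (Phi f s t)^(l+3) := by
  have hv := slice_vol_ge l hq
  have hv0 := slice_vol_pos l hq
  refine ⟨(volume.real (slice (l+2)))⁻¹ * (2*Real.pi)⁻¹, by positivity, ?_, ?_⟩
  · rw [← mul_inv]
    have hs : 0 < √((l:ℝ)+3) := by positivity
    rw [inv_le_comm₀ (by positivity) hs]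
    have h2 : 0 < 2 * Real.pi := by positivity
    have := mul_le_mul_of_nonneg_right hv h2.le
    calc (√((l:ℝ)+3))⁻¹ = (2 * Real.pi)⁻¹ * (1 / √((l:ℝ)+3)) * (2*Real.pi) := by field_simp
      _ ≤ _ := this
  · rw [cond_integral, slice_fourier (l+2) (by omega) f hf D hD hc s]
    push_cast; ring

lemma re_int (N : ℕ) (P : Measure (Fin N → ℝ)) [IsProbabilityMeasure P] (h : (Fin N → ℝ) → ℝ) (hh : Measurable h) :
    (∫ a, Complex.exp ((h a : ℂ) * Complex.I) ∂P).re = ∫ a, Real.cos (h a) ∂P ∧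
    (∫ a, Complex.exp ((h a : ℂ) * Complex.I) ∂P).im = ∫ a, Real.sin (h a) ∂P := by
  have hi : Integrable (fun a => Complex.exp ((h a : ℂ) * Complex.I)) P := by
    refine Integrable.of_bound (Measurable.aestronglyMeasurable (by fun_prop)) 1 (ae_of_all _ fun x => ?_)
    rw [Complex.norm_exp_ofReal_mul_I]
  constructor
  · refine (integral_re (𝕜 := ℂ) hi).symm.trans ?_
    congr 1; ext a; exact Complex.exp_ofReal_mul_I_re _
  · refine (integral_im (𝕜 := ℂ) hi).symm.trans ?_
    congr 1; ext a; exact Complex.exp_ofReal_mul_I_im _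

set_option maxHeartbeats 1000000 in
lemma E_main (l : ℕ) (hf : Measurable f) (hK : ∀ x ∈ Ioc (0:ℝ) 1, |f x| ≤ K) (hK0 : 0 < K)
    (h0 : ∫ x in Ioc (0:ℝ) 1, f x = 0) (h1 : ∫ x in Ioc (0:ℝ) 1, f x * (x - 1/2) = 0)
    (hV : V ≤ ∫ x in Ioc (0:ℝ) 1, f x ^ 2) (hV0 : 0 < V)
    (D : Set ℝ) (hD : D.Countable) (hc : ∀ x, x ∉ D → ContinuousAt f x)
    (M : ℝ) (hM : ∀ a, |score (l+2) f a| ≤ M)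
    (hq : 0.995^l * √((l:ℝ)+3) ≤ 1/8) (R τ : ℝ) (hR : 1 ≤ R) (hτ : τ = 100 * K * R)
    (α β : ℝ) (hα : α = ((l:ℝ)+3)*V/10) (hβ : β = ((l:ℝ)+3)/120) :
    |(cond volume (slice (l+2))).real {a | 0 < score (l+2) f a} - 1/2| ≤
      √((l:ℝ)+3) * (((l:ℝ)+3) * K * ((K^2/α + 1/β) * √(Real.pi / (β/2)))) / √α
      + √((l:ℝ)+3) * (((l:ℝ)+3) * K * (0.995^l * (2 * Real.pi))) / τ
      + √((l:ℝ)+3) * √(Real.pi / β) * τ / √α + √((l:ℝ)+3) * (0.995^l * (2 * Real.pi))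
      + 4 * Real.exp (-(R^2/4)) := by
  set P := cond volume (slice (l+2)) with hP
  have : IsProbabilityMeasure P := slice_prob l hq
  set r := √((l:ℝ)+3) with hr
  have hr0 : 0 < r := by positivity
  have hb : 0 < β := by rw [hβ]; positivity
  have ha : 0 < α := by rw [hα]; positivity
  have hτ0 : 0 < τ := by rw [hτ]; positivity
  set B1 := r * (((l:ℝ)+3) * K * ((K^2/α + 1/β) * √(Real.pi / (β/2)))) with hB1
  set Q1 := r * (((l:ℝ)+3) * K * (0.995^l * (2 * Real.pi))) with hQ1
  set B2 := r * √(Real.pi / β) with hB2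
  set Q2 := r * (0.995^l * (2 * Real.pi)) with hQ2
  have hB10 : 0 ≤ B1 := by positivity
  have hQ10 : 0 ≤ Q1 := by positivity
  have hB20 : 0 ≤ B2 := by positivity
  have hQ20 : 0 ≤ Q2 := by positivity
  have hm := score_measurable (l+2) f hf
  have hsin : ∀ s : ℝ, |s| * K ≤ 1/100 → |∫ a, Real.sin (s * score (l+2) f a) ∂P| ≤ |s| * (B1 * Real.exp (-(α/2) * s^2) + Q1) := by
    intro s hs
    obtain ⟨κ, k0, k1, k2⟩ := cond_char f l hf D hD hc s hq
    have hri := (re_int (l+2) P (fun a => s * score (l+2) f a) (by fun_prop)).2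
    rw [← hri, k2, Complex.im_ofReal_mul, abs_mul, abs_of_nonneg k0]
    have := Phi_im_int f K V hf hK hK0.le h0 h1 hV hV0 s hs l α β hα hβ
    calc κ * |(∫ t, (Phi f s t)^(l+3)).im| ≤ r * (|s| * (((l:ℝ)+3) * K * ((K^2/α + 1/β) * √(Real.pi / (β/2)) * Real.exp (-(α/2) * s^2)
      + 0.995^l * (2 * Real.pi)))) := by gcongr
      _ = _ := by rw [hB1, hQ1]; ring
  have hcos : ∀ s : ℝ, |s| * K ≤ 1/100 → |∫ a, Real.cos (s * score (l+2) f a) ∂P| ≤ B2 * Real.exp (-(α/2) * s^2) + Q2 := by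
    intro s hs
    obtain ⟨κ, k0, k1, k2⟩ := cond_char f l hf D hD hc s hq
    have hri := (re_int (l+2) P (fun a => s * score (l+2) f a) (by fun_prop)).1
    rw [← hri, k2, Complex.re_ofReal_mul, abs_mul, abs_of_nonneg k0]
    have := (Complex.abs_re_le_norm _).trans (Phi_normpow_int f K V hf hK h0 h1 hV hV0.le s hs l)
    rw [← hα, ← hβ] at this
    have m1 : Real.exp (-α * s^2) ≤ Real.exp (-(α/2) * s^2) := Real.exp_le_exp.2 (by nlinarith [sq_nonneg s])
    calc κ * |(∫ t, (Phi f s t)^(l+3)).re| ≤ r * (Real.exp (-α * s^2) * √(Real.pi / β) + 0.995^l * (2 * Real.pi)) := by gcongr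
      _ ≤ r * (Real.exp (-(α/2) * s^2) * √(Real.pi / β) + 0.995^l * (2 * Real.pi)) := by gcongr
      _ = _ := by rw [hB2, hQ2]; ring
  have hpow : ∀ ξ : ℝ, -(α/2) * (ξ/τ)^2 = -(α/2/τ^2) * ξ^2 := fun ξ => by ring
  have hsmall : ∀ ξ : ℝ, |ξ| ≤ R → |ξ/τ| * K ≤ 1/100 := by
    intro ξ hξ
    rw [abs_div, abs_of_pos hτ0, div_mul_eq_mul_div, div_le_iff₀ hτ0, hτ]
    nlinarith
  have hbig : ∀ ξ : ℝ, R < |ξ| → 1 ≤ Real.exp (-(R^2/4)) * Real.exp (-(-(1/4)) * ξ^2) := by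
    intro ξ hξ
    rw [← Real.exp_add]
    apply Real.one_le_exp
    rw [← sq_abs ξ]; nlinarith
  obtain ⟨g1, g2⟩ := gauss_int_exp (α/2/τ^2) (by have : 0 < α/2/τ^2 := by positivity
                                                 linarith)
  obtain ⟨g3, g4⟩ := gauss_int_exp (-(1/4)) (by norm_num)
  set b1 : ℝ → ℝ := fun ξ => τ⁻¹ * (B1 * Real.exp (-(α/2/τ^2) * ξ^2) + Q1) + Real.exp (-(R^2/4)) * Real.exp (-(-(1/4)) * ξ^2) with hb1
  set b2 : ℝ → ℝ := fun ξ => (B2 * Real.exp (-(α/2/τ^2) * ξ^2) + Q2) + Real.exp (-(R^2/4)) * Real.exp (-(-(1/4)) * ξ^2) with hb2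
  have j1 : Integrable (fun ξ => B1 * Real.exp (-(α/2/τ^2) * ξ^2) + Q1) (gaussianReal 0 1) := (g1.const_mul _).add (integrable_const _)
  have j2 : Integrable (fun ξ => B2 * Real.exp (-(α/2/τ^2) * ξ^2) + Q2) (gaussianReal 0 1) := (g1.const_mul _).add (integrable_const _)
  have hs := smoothing P (fun a => score (l+2) f a / τ) (hm.div_const _) (M/τ)
    (fun a => by rw [abs_div, abs_of_pos hτ0]; gcongr; exact hM a) b1 b2
    ((j1.const_mul _).add (g3.const_mul _)) (j2.add (g3.const_mul _)) ?_ ?_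
  rotate_left
  · intro ξ hξ
    have e : ∀ a, ξ * (score (l+2) f a / τ) = (ξ/τ) * score (l+2) f a := fun a => by ring
    simp_rw [e]
    rcases le_or_gt |ξ| R with hle | hgt
    · have := hsin (ξ/τ) (hsmall ξ hle)
      rw [hpow] at this
      refine this.trans ?_
      rw [abs_div, abs_of_pos hτ0, hb1]
      have : 0 ≤ |ξ| * (Real.exp (-(R^2/4)) * Real.exp (-(-(1/4)) * ξ^2)) := by positivity
      calc _ = |ξ| * (τ⁻¹ * (B1 * Real.exp (-(α/2/τ^2) * ξ^2) + Q1)) := by ring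
        _ ≤ _ := by rw [mul_add |ξ|]; linarith
    · have h1 : |∫ a, Real.sin ((ξ/τ) * score (l+2) f a) ∂P| ≤ 1 := by
        have := norm_integral_le_of_norm_le_const (μ := P) (f := fun a => Real.sin ((ξ/τ) * score (l+2) f a)) (C := 1)
          (ae_of_all _ fun a => Real.abs_sin_le_one _)
        simpa using this
      refine h1.trans ?_
      have h2 := hbig ξ hgt
      have h3 : 0 ≤ τ⁻¹ * (B1 * Real.exp (-(α/2/τ^2) * ξ^2) + Q1) := by positivity
      have h4 : 1 ≤ b1 ξ := by rw [hb1]; dsimp only; linarith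
      have h5 : 1 ≤ |ξ| := hR.trans hgt.le
      calc (1:ℝ) = 1 * 1 := by norm_num
        _ ≤ |ξ| * b1 ξ := mul_le_mul h5 h4 zero_le_one (abs_nonneg _)
  · intro ξ
    have e : ∀ a, ξ * (score (l+2) f a / τ) = (ξ/τ) * score (l+2) f a := fun a => by ring
    simp_rw [e]
    rcases le_or_gt |ξ| R with hle | hgt
    · have := hcos (ξ/τ) (hsmall ξ hle)
      rw [hpow] at this
      refine this.trans ?_
      rw [hb2]
      have : 0 ≤ (Real.exp (-(R^2/4)) * Real.exp (-(-(1/4)) * ξ^2)) := by positivity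
      dsimp only; linarith
    · have h1 : |∫ a, Real.cos ((ξ/τ) * score (l+2) f a) ∂P| ≤ 1 := by
        have := norm_integral_le_of_norm_le_const (μ := P) (f := fun a => Real.cos ((ξ/τ) * score (l+2) f a)) (C := 1)
          (ae_of_all _ fun a => Real.abs_cos_le_one _)
        simpa using this
      refine h1.trans ?_
      have h2 := hbig ξ hgt
      have h3 : 0 ≤ (B2 * Real.exp (-(α/2/τ^2) * ξ^2) + Q2) := by positivity
      rw [hb2]; dsimp only; linarith
  have hset : {a | 0 < score (l+2) f a / τ} = {a | 0 < score (l+2) f a} := by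
    ext a; simp only [mem_ofPred_eq]; rw [lt_div_iff₀ hτ0, zero_mul]
  rw [hset] at hs
  refine hs.trans ?_
  have hG : (√(1 + 2*(α/2/τ^2)))⁻¹ ≤ τ / √α := by
    rw [inv_le_comm₀ (by positivity) (by positivity), inv_div]
    apply Real.le_sqrt_of_sq_le
    rw [div_pow, Real.sq_sqrt ha.le]
    have : 2 * (α/2/τ^2) = α/τ^2 := by ring
    rw [this]; linarith
  have hG2 : (√(1 + 2*(-(1/4))) : ℝ)⁻¹ ≤ 2 := by
    rw [inv_le_comm₀ (by norm_num) (by norm_num)]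
    apply Real.le_sqrt_of_sq_le; norm_num
  have I1 : ∫ ξ, b1 ξ ∂(gaussianReal 0 1) = τ⁻¹ * (B1 * (√(1 + 2*(α/2/τ^2)))⁻¹ + Q1) + Real.exp (-(R^2/4)) * (√(1 + 2*(-(1/4))) : ℝ)⁻¹ := by
    rw [hb1, integral_add (j1.const_mul _) (g3.const_mul _), integral_const_mul, integral_add (g1.const_mul _) (integrable_const _),
      integral_const_mul, integral_const, integral_const_mul, g2, g4]; simp
  have I2 : ∫ ξ, b2 ξ ∂(gaussianReal 0 1) = (B2 * (√(1 + 2*(α/2/τ^2)))⁻¹ + Q2) + Real.exp (-(R^2/4)) * (√(1 + 2*(-(1/4))) : ℝ)⁻¹ := by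
    rw [hb2, integral_add j2 (g3.const_mul _), integral_add (g1.const_mul _) (integrable_const _),
      integral_const_mul, integral_const, integral_const_mul, g2, g4]; simp
  rw [I1, I2]
  have hsa : 0 < √α := by positivity
  have k1 : τ⁻¹ * (B1 * (√(1 + 2*(α/2/τ^2)))⁻¹ + Q1) ≤ B1/√α + Q1/τ := by
    calc _ ≤ τ⁻¹ * (B1 * (τ/√α) + Q1) := by gcongr
      _ = _ := by field_simp
  have k2 : B2 * (√(1 + 2*(α/2/τ^2)))⁻¹ ≤ B2 * τ / √α := by
    calc _ ≤ B2 * (τ/√α) := by gcongr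
      _ = _ := by ring
  have k3 : Real.exp (-(R^2/4)) * (√(1 + 2*(-(1/4))) : ℝ)⁻¹ ≤ Real.exp (-(R^2/4)) * 2 := by gcongr
  linarith
end G

lemma cos_int_zero (l : ℤ) (hl : l ≠ 0) : ∫ x in Ioc (0:ℝ) 1, Real.cos (2 * Real.pi * l * x) = 0 := by
  rw [← intervalIntegral.integral_of_le zero_le_one]
  have hc : (2 * Real.pi * l : ℝ) ≠ 0 := by
    have := Real.pi_pos.ne'
    have : (l:ℝ) ≠ 0 := by exact_mod_cast hl
    positivity
  rw [intervalIntegral.integral_comp_mul_left (fun x => Real.cos x) hc, integral_cos]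
  have : Real.sin (2 * Real.pi * l * 1) = 0 := by
    rw [Real.sin_eq_zero_iff]; exact ⟨2 * l, by push_cast; ring⟩
  rw [this]; simp

lemma sin_int_zero (l : ℤ) : ∫ x in Ioc (0:ℝ) 1, Real.sin (2 * Real.pi * l * x) = 0 := by
  rcases eq_or_ne l 0 with rfl | hl
  · simp
  rw [← intervalIntegral.integral_of_le zero_le_one]
  have hc : (2 * Real.pi * l : ℝ) ≠ 0 := by
    have := Real.pi_pos.ne'
    have : (l:ℝ) ≠ 0 := by exact_mod_cast hl
    positivity
  rw [intervalIntegral.integral_comp_mul_left (fun x => Real.sin x) hc, integral_sin]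
  have : Real.cos (2 * Real.pi * l * 1) = 1 := by
    rw [Real.cos_eq_one_iff]; exact ⟨l, by ring⟩
  rw [this]; simp

/-- the sine basis -/
noncomputable def sn (k : ℕ) (x : ℝ) : ℝ := Real.sin (2 * Real.pi * ((k:ℝ)+1) * x)

lemma sn_meas (k : ℕ) : Measurable (sn k) := by unfold sn; fun_prop

lemma sn_le (k : ℕ) (x : ℝ) : |sn k x| ≤ 1 := Real.abs_sin_le_one _

lemma sn_int (k : ℕ) : ∫ x in Ioc (0:ℝ) 1, sn k x = 0 := by
  have := sin_int_zero (k+1)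
  push_cast at this; exact this

lemma sn_orth (j k : ℕ) : ∫ x in Ioc (0:ℝ) 1, sn j x * sn k x = if j = k then 1/2 else 0 := by
  have e : ∀ x, sn j x * sn k x = 1/2 * (Real.cos (2 * Real.pi * (((j:ℤ) - k : ℤ) : ℝ) * x) - Real.cos (2 * Real.pi * (((j:ℤ) + k + 2 : ℤ) : ℝ) * x)) := by
    intro x
    have h1 : (2 * Real.pi * (((j:ℤ) - k : ℤ) : ℝ) * x) = 2 * Real.pi * ((j:ℝ)+1) * x - 2 * Real.pi * ((k:ℝ)+1) * x := by push_cast; ring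
    have h2 : (2 * Real.pi * (((j:ℤ) + k + 2 : ℤ) : ℝ) * x) = 2 * Real.pi * ((j:ℝ)+1) * x + 2 * Real.pi * ((k:ℝ)+1) * x := by push_cast; ring
    rw [h1, h2, Real.cos_sub, Real.cos_add, sn, sn]; ring
  simp_rw [e]
  have ic : ∀ c : ℝ, Integrable (fun x => Real.cos (c * x)) (volume.restrict (Ioc (0:ℝ) 1)) := fun c =>
    unif_bdd_integrable _ (by fun_prop) 1 fun x _ => Real.abs_cos_le_one _
  rw [integral_const_mul, integral_sub (ic _) (ic _), cos_int_zero ((j:ℤ)+k+2) (by omega)]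
  split_ifs with h
  · subst h; simp
  · rw [cos_int_zero _ (by omega)]; simp

lemma hxi_var {m : ℕ} (ξ : Fin m → ℝ) : 
    ∫ x in Ioc (0:ℝ) 1, (∑ k, ξ k * sn k x)^2 = (∑ k, ξ k ^2)/2 := by
  have e : ∀ x, (∑ k, ξ k * sn k x)^2 = ∑ j, ∑ k, (ξ j * ξ k) * (sn j x * sn k x) := by
    intro x
    rw [sq, Finset.sum_mul_sum]
    refine Finset.sum_congr rfl fun j _ => Finset.sum_congr rfl fun k _ => by ring
  simp_rw [e]
  have i : ∀ j k : ℕ, Integrable (fun x => sn j x * sn k x) (volume.restrict (Ioc (0:ℝ) 1)) := fun j k =>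
    unif_bdd_integrable _ ((sn_meas j).mul (sn_meas k)) 1 fun x _ => by
      rw [abs_mul]; exact mul_le_one₀ (sn_le _ _) (abs_nonneg _) (sn_le _ _)
  have i2 : ∀ j : Fin m, Integrable (fun x => ∑ k : Fin m, (ξ j * ξ k) * (sn j x * sn k x)) (volume.restrict (Ioc (0:ℝ) 1)) :=
    fun j => integrable_finsetSum _ fun k _ => (i j k).const_mul _
  rw [integral_finsetSum _ fun j _ => i2 j]
  rw [Finset.sum_div]
  refine Finset.sum_congr rfl fun j _ => ?_
  rw [integral_finsetSum _ fun (k : Fin m) _ => (i j k).const_mul _]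
  simp_rw [integral_const_mul, sn_orth]
  simp only [← Fin.ext_iff, mul_ite, mul_zero]
  rw [Finset.sum_ite_eq]; simp; ring

lemma phi_xi_le {m : ℕ} (ξ : Fin m → ℝ) (r : ℝ) (hr : 0 < r) (h : ∑ k, |ξ k| ≤ r) :
    ‖∫ x in Ioc (0:ℝ) 1, Complex.exp (((∑ k, (ξ k / r) * sn k x : ℝ) : ℂ) * Complex.I)‖ ≤ Real.exp (-((∑ k, ξ k^2)/(10 * r^2))) := by
  have hm : Measurable (fun x => ∑ k, (ξ k / r) * sn (k:ℕ) x) := 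
    Finset.measurable_sum _ fun k _ => (sn_meas k).const_mul _
  have hi : ∀ k : Fin m, Integrable (fun x => (ξ k / r) * sn (k:ℕ) x) (volume.restrict (Ioc (0:ℝ) 1)) := fun k =>
    (unif_bdd_integrable _ (sn_meas k) 1 fun x _ => sn_le _ _).const_mul _
  have := norm_charint_le (volume.restrict (Ioc (0:ℝ) 1)) _ hm.aemeasurable (ae_of_all _ fun x => ?_) ?_
  · refine this.trans (Real.exp_le_exp.2 (le_of_eq ?_))
    rw [hxi_var]
    simp_rw [div_pow]
    rw [← Finset.sum_div]; field_simp; ring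
  · calc |∑ k, (ξ k / r) * sn (k:ℕ) x| ≤ ∑ k, |(ξ k / r) * sn (k:ℕ) x| := Finset.abs_sum_le_sum_abs _ _
      _ ≤ ∑ k, |ξ k| / r := by
        refine Finset.sum_le_sum fun k _ => ?_
        rw [abs_mul, abs_div, abs_of_pos hr]
        exact mul_le_of_le_one_right (by positivity) (sn_le _ _)
      _ = (∑ k, |ξ k|)/r := by rw [Finset.sum_div]
      _ ≤ 1 := by rw [div_le_one hr]; exact h
  · rw [integral_finsetSum _ fun k _ => hi k]
    simp [integral_const_mul, sn_int]

/-- iid uniform -/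
noncomputable abbrev QQ (N : ℕ) : Measure (Fin N → ℝ) := Measure.pi (fun _ => volume.restrict (Ioc (0:ℝ) 1))

noncomputable abbrev GG (m : ℕ) : Measure (Fin m → ℝ) := Measure.pi (fun _ => gaussianReal 0 1)

lemma gauss_pi_char {m : ℕ} (d : Fin m → ℝ) :
    ∫ ξ, Complex.exp (((∑ k, ξ k * d k : ℝ) : ℂ) * Complex.I) ∂(GG m) = ((Real.exp (-(∑ k, d k^2)/2) : ℝ) : ℂ) := by
  have e : ∀ ξ : Fin m → ℝ, Complex.exp (((∑ k, ξ k * d k : ℝ) : ℂ) * Complex.I) = ∏ k, Complex.exp (((ξ k * d k : ℝ) : ℂ) * Complex.I) := by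
    intro ξ; rw [← Complex.exp_sum]; congr 1; push_cast; rw [Finset.sum_mul]
  simp_rw [e]
  rw [integral_fintype_prod_eq_prod (𝕜 := ℂ) (fun k x => Complex.exp (((x * d k : ℝ) : ℂ) * Complex.I))]
  simp_rw [gauss_char]
  rw [← Complex.exp_sum]
  push_cast
  congr 1
  rw [← Finset.sum_div, Finset.sum_neg_distrib]

lemma iid_char {m N : ℕ} (ξ : Fin m → ℝ) (r : ℝ) :
    ∫ a, Complex.exp (((∑ k, ξ k * ((∑ i, sn k (a i))/r) : ℝ) : ℂ) * Complex.I) ∂(QQ N) = 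
      (∫ x in Ioc (0:ℝ) 1, Complex.exp (((∑ k, (ξ k / r) * sn k x : ℝ) : ℂ) * Complex.I))^N := by
  have e : ∀ a : Fin N → ℝ, Complex.exp (((∑ k, ξ k * ((∑ i, sn k (a i))/r) : ℝ) : ℂ) * Complex.I) = 
      ∏ i, Complex.exp (((∑ k, (ξ k / r) * sn k (a i) : ℝ) : ℂ) * Complex.I) := by
    intro a
    rw [← Complex.exp_sum, ← Finset.sum_mul]
    congr 2
    rw [← Complex.ofReal_sum, Finset.sum_comm]
    congr 1
    refine Finset.sum_congr rfl fun k _ => ?_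
    rw [← Finset.mul_sum]; ring
  simp_rw [e]
  rw [integral_fintype_prod_eq_prod (𝕜 := ℂ) (fun _ x => Complex.exp (((∑ k, (ξ k / r) * sn k x : ℝ) : ℂ) * Complex.I))]
  simp

lemma small_ball (m N : ℕ) (r : ℝ) (hr : 0 < r) (hm : 0 < m) :
    (QQ N).real {a | ∀ k : Fin m, |∑ i, sn k (a i)| ≤ r} ≤
     Real.exp (m/2) * ((√(1 + 2 * (N/(10*r^2))))⁻¹^m + m * (Real.exp (-((r/m)^2/4)) * 2)) := by
  have hms : MeasurableSet {a : Fin N → ℝ | ∀ k : Fin m, |∑ i, sn k (a i)| ≤ r} := by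
    have : {a : Fin N → ℝ | ∀ k : Fin m, |∑ i, sn k (a i)| ≤ r} = ⋂ k : Fin m, {a : Fin N → ℝ | |∑ i, sn k (a i)| ≤ r} := by ext a; simp
    rw [this]
    refine MeasurableSet.iInter fun k => measurableSet_le ?_ measurable_const
    exact (Finset.measurable_sum _ fun i _ => (sn_meas k).comp (measurable_pi_apply i)).abs
  have hDm : ∀ k : ℕ, Measurable (fun a : Fin N → ℝ => ∑ i, sn k (a i)) := fun k =>
    Finset.measurable_sum _ fun i _ => (sn_meas k).comp (measurable_pi_apply i)
  -- step 1
  have hem : Measurable fun a : Fin N → ℝ => Real.exp (-(∑ k : Fin m, ((∑ i, sn k (a i))/r)^2)/2) := by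
    apply Real.measurable_exp.comp
    have : Measurable fun a : Fin N → ℝ => ∑ k : Fin m, ((∑ i, sn k (a i))/r)^2 :=
      Finset.measurable_sum _ fun k _ => (((hDm k).div_const r).pow_const 2)
    fun_prop
  have hei : Integrable (fun a : Fin N → ℝ => Real.exp (-(∑ k : Fin m, ((∑ i, sn k (a i))/r)^2)/2)) (QQ N) := by
    refine Integrable.of_bound hem.aestronglyMeasurable 1 (ae_of_all _ fun a => ?_)
    rw [Real.norm_eq_abs, Real.abs_exp]
    apply Real.exp_le_one_iff.2
    have : 0 ≤ ∑ k : Fin m, ((∑ i, sn k (a i))/r)^2 := by positivity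
    linarith
  have s1 : (QQ N).real {a | ∀ k : Fin m, |∑ i, sn k (a i)| ≤ r} ≤ Real.exp (m/2) * ∫ a, Real.exp (-(∑ k : Fin m, ((∑ i, sn k (a i))/r)^2)/2) ∂(QQ N) := by
    rw [← integral_const_mul, ← integral_indicator_one hms]
    refine integral_mono ((integrable_const (1:ℝ)).indicator hms) (hei.const_mul _) fun a => ?_
    rw [indicator_apply]
    split_ifs with ha
    · rw [← Real.exp_add]
      apply Real.one_le_exp
      have : ∑ k : Fin m, ((∑ i, sn k (a i))/r)^2 ≤ ∑ k : Fin m, (1:ℝ) := by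
        refine Finset.sum_le_sum fun k _ => ?_
        rw [div_pow, div_le_one (by positivity), ← sq_abs]
        exact pow_le_pow_left₀ (abs_nonneg _) (ha k) 2
      simp at this
      linarith
    · positivity
  refine s1.trans ?_
  gcongr
  -- step 2: swap
  have hmeas2 : Measurable fun p : (Fin N → ℝ) × (Fin m → ℝ) => Complex.exp (((∑ k, p.2 k * ((∑ i, sn k (p.1 i))/r) : ℝ) : ℂ) * Complex.I) := by
    have : Measurable fun p : (Fin N → ℝ) × (Fin m → ℝ) => ∑ k, p.2 k * ((∑ i, sn k (p.1 i))/r) := by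
      refine Finset.measurable_sum _ fun k _ => ?_
      exact ((measurable_pi_apply k).comp measurable_snd).mul (((hDm k).comp measurable_fst).div_const r)
    fun_prop
  have hIntg2 : Integrable (fun p : (Fin N → ℝ) × (Fin m → ℝ) => Complex.exp (((∑ k, p.2 k * ((∑ i, sn k (p.1 i))/r) : ℝ) : ℂ) * Complex.I)) ((QQ N).prod (GG m)) := by
    refine Integrable.of_bound hmeas2.aestronglyMeasurable 1 (ae_of_all _ fun x => ?_)
    rw [Complex.norm_exp_ofReal_mul_I]
  have hsw := integral_integral_swap (f := fun (a : Fin N → ℝ) (ξ : Fin m → ℝ) => Complex.exp (((∑ k, ξ k * ((∑ i, sn k (a i))/r) : ℝ) : ℂ) * Complex.I)) hIntg2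
  simp_rw [gauss_pi_char, iid_char] at hsw
  rw [integral_complex_ofReal] at hsw
  have hle : ∫ a, Real.exp (-(∑ k : Fin m, ((∑ i, sn k (a i))/r)^2)/2) ∂(QQ N) ≤ 
     ‖∫ ξ, (∫ x in Ioc (0:ℝ) 1, Complex.exp (((∑ k : Fin m, (ξ k / r) * sn k x : ℝ) : ℂ) * Complex.I))^N ∂(GG m)‖ := by
    rw [← hsw, Complex.norm_real]; exact Real.le_norm_self _
  refine hle.trans ?_
  obtain ⟨g1, g2⟩ := gauss_int_exp (N/(10*r^2)) (by have : 0 ≤ N/(10*r^2) := by positivity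
                                                    linarith)
  obtain ⟨g3, g4⟩ := gauss_int_exp (-(1/4)) (by norm_num)
  have p1 : Integrable (fun ξ : Fin m → ℝ => ∏ k, Real.exp (-(N/(10*r^2)) * (ξ k)^2)) (GG m) :=
    Integrable.fintype_prod (f := fun _ x => Real.exp (-(N/(10*r^2)) * x^2)) fun _ => g1
  have p2 : ∀ k : Fin m, Integrable (fun ξ : Fin m → ℝ => Real.exp (-((r/m)^2/4)) * Real.exp (-(-(1/4)) * (ξ k)^2)) (GG m) := fun k =>
    ((measurePreserving_eval (fun _ : Fin m => gaussianReal 0 1) k).integrable_comp_of_integrable g3).const_mul _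
  have hpt : ∀ ξ : Fin m → ℝ, ‖(∫ x in Ioc (0:ℝ) 1, Complex.exp (((∑ k : Fin m, (ξ k / r) * sn k x : ℝ) : ℂ) * Complex.I))^N‖ ≤
      ∏ k, Real.exp (-(N/(10*r^2)) * (ξ k)^2) + ∑ k, Real.exp (-((r/m)^2/4)) * Real.exp (-(-(1/4)) * (ξ k)^2) := by
    intro ξ
    rw [norm_pow]
    have q1 : 0 ≤ ∏ k, Real.exp (-(N/(10*r^2)) * (ξ k)^2) := by positivity
    have q2 : 0 ≤ ∑ k, Real.exp (-((r/m)^2/4)) * Real.exp (-(-(1/4)) * (ξ k)^2) := by positivity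
    rcases le_or_gt (∑ k, |ξ k|) r with h | h
    · have := pow_le_pow_left₀ (norm_nonneg _) (phi_xi_le ξ r hr h) N
      refine this.trans ?_
      rw [← Real.exp_nat_mul]
      have e : ∏ k, Real.exp (-(N/(10*r^2)) * (ξ k)^2) = Real.exp (N * (-((∑ k, ξ k^2)/(10 * r^2)))) := by
        rw [← Real.exp_sum, ← Finset.mul_sum]; congr 1; ring
      rw [e] at q1 ⊢
      linarith
    · have h1 : ‖∫ x in Ioc (0:ℝ) 1, Complex.exp (((∑ k : Fin m, (ξ k / r) * sn k x : ℝ) : ℂ) * Complex.I)‖^N ≤ 1 := by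
        apply pow_le_one₀ (norm_nonneg _)
        have := norm_integral_le_of_norm_le_const (μ := volume.restrict (Ioc (0:ℝ) 1)) (f := fun x => Complex.exp (((∑ k : Fin m, (ξ k / r) * sn k x : ℝ) : ℂ) * Complex.I)) (C := 1)
          (ae_of_all _ fun a => by rw [Complex.norm_exp_ofReal_mul_I])
        simpa using this
      have : ∃ k, r/m < |ξ k| := by
        by_contra hcon
        push Not at hcon
        have : ∑ k, |ξ k| ≤ ∑ k : Fin m, r/m := Finset.sum_le_sum fun k _ => hcon k
        simp at this
        have hm' : (m:ℝ) ≠ 0 := by positivity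
        rw [mul_div_cancel₀ _ hm'] at this
        linarith
      obtain ⟨k, hk⟩ := this
      have h2 : 1 ≤ Real.exp (-((r/m)^2/4)) * Real.exp (-(-(1/4)) * (ξ k)^2) := by
        rw [← Real.exp_add]
        apply Real.one_le_exp
        have : (r/m)^2 ≤ |ξ k|^2 := pow_le_pow_left₀ (by positivity) hk.le 2
        rw [sq_abs] at this
        linarith
      have h3 := Finset.single_le_sum (f := fun k => Real.exp (-((r/m)^2/4)) * Real.exp (-(-(1/4)) * (ξ k)^2)) (fun _ _ => by positivity) (Finset.mem_univ k)
      linarith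
  refine (norm_integral_le_of_norm_le (p1.add (integrable_finsetSum _ fun k _ => p2 k)) (ae_of_all _ hpt)).trans ?_
  simp only [Pi.add_apply]
  have e1 : ∫ ξ : Fin m → ℝ, ∏ k, Real.exp (-(N/(10*r^2)) * (ξ k)^2) ∂(GG m) = (√(1 + 2 * (N/(10*r^2))))⁻¹^m := by
    rw [integral_fintype_prod_eq_prod (𝕜 := ℝ) (fun _ x => Real.exp (-(N/(10*r^2)) * x^2))]
    simp_rw [g2]; simp
  have hG2 : (√(1 + 2*(-(1/4))) : ℝ)⁻¹ ≤ 2 := by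
    rw [inv_le_comm₀ (by norm_num) (by norm_num)]
    apply Real.le_sqrt_of_sq_le; norm_num
  have e2 : ∀ k : Fin m, ∫ ξ : Fin m → ℝ, Real.exp (-((r/m)^2/4)) * Real.exp (-(-(1/4)) * (ξ k)^2) ∂(GG m) ≤ Real.exp (-((r/m)^2/4)) * 2 := by
    intro k
    rw [integral_const_mul]
    gcongr
    have := integral_comp_eval (μ := fun _ : Fin m => gaussianReal 0 1) (i := k) (f := fun x => Real.exp (-(-(1/4)) * x^2)) g3.aestronglyMeasurable
    rw [this, g4]
    exact hG2
  have : Integrable (fun ξ : Fin m → ℝ => ∑ k, Real.exp (-((r/m)^2/4)) * Real.exp (-(-(1/4)) * (ξ k)^2)) (GG m) := integrable_finsetSum _ fun k _ => p2 k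
  rw [integral_add p1 this, e1, integral_finsetSum _ fun k _ => p2 k]
  have : ∑ k : Fin m, ∫ ξ : Fin m → ℝ, Real.exp (-((r/m)^2/4)) * Real.exp (-(-(1/4)) * (ξ k)^2) ∂(GG m) ≤ ∑ k : Fin m, Real.exp (-((r/m)^2/4)) * 2 :=
    Finset.sum_le_sum fun k _ => e2 k
  simp at this ⊢
  linarith

lemma hoeff (N : ℕ) (h : ℝ → ℝ) (hh : Measurable h) (lo : ℝ) (hb : ∀ x, h x ∈ Icc lo (lo+1))
    (h0 : ∫ x in Ioc (0:ℝ) 1, h x = 0) (ε : ℝ) (hε : 0 ≤ ε) :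
    (QQ N).real {a | ε ≤ ∑ i, h (a i)} ≤ Real.exp (-(2 * ε^2 / N)) := by
  have hind : iIndepFun (fun (i : Fin N) (a : Fin N → ℝ) => h (a i)) (QQ N) :=
    iIndepFun_pi (X := fun _ => h) fun _ => hh.aemeasurable
  have hsub : ∀ i ∈ (Finset.univ : Finset (Fin N)), HasSubgaussianMGF (fun a : Fin N → ℝ => h (a i)) ((‖(lo+1) - lo‖₊ / 2) ^ 2) (QQ N) := by
    intro i _
    refine hasSubgaussianMGF_of_mem_Icc_of_integral_eq_zero (hh.comp (measurable_pi_apply i)).aemeasurable (ae_of_all _ fun a => hb _) ?_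
    rw [integral_comp_eval (μ := fun _ : Fin N => volume.restrict (Ioc (0:ℝ) 1)) (i := i) (f := h) hh.aestronglyMeasurable, h0]
  have := HasSubgaussianMGF.measure_sum_ge_le_of_iIndepFun hind hsub hε
  refine this.trans (le_of_eq ?_)
  congr 1
  simp
  rcases Nat.eq_zero_or_pos N with rfl | hN
  · simp
  · have : (N:ℝ) ≠ 0 := by positivity
    field_simp

lemma step_int (x : ℝ) (hx : x ∈ Icc (0:ℝ) 1) :
    ∫ y in Ioc (0:ℝ) 1, ((if y ≤ x then (1:ℝ) else 0) - x) = 0 := by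
  have e : (fun y : ℝ => if y ≤ x then (1:ℝ) else 0) = (Iic x).indicator 1 := by
    ext y; simp [indicator_apply]
  have hi : Integrable (fun y : ℝ => if y ≤ x then (1:ℝ) else 0) (volume.restrict (Ioc (0:ℝ) 1)) := by
    rw [e]; exact (integrable_const (1:ℝ)).indicator measurableSet_Iic
  rw [integral_sub hi (integrable_const _), e, integral_indicator_one measurableSet_Iic]
  have : (volume.restrict (Ioc (0:ℝ) 1)).real (Iic x) = x := by
    rw [Measure.real, Measure.restrict_apply measurableSet_Iic, inter_comm, Ioc_inter_Iic, Real.volume_Ioc, min_eq_right hx.2]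
    simp [hx.1]
  rw [this]; simp

lemma count_dev (N : ℕ) (x u : ℝ) (hx : x ∈ Icc (0:ℝ) 1) (hu : 0 ≤ u) :
    (QQ N).real {a | u ≤ |∑ i, ((if a i ≤ x then (1:ℝ) else 0) - x)|} ≤ 2 * Real.exp (-(2 * u^2 / N)) := by
  have hm : Measurable (fun y : ℝ => (if y ≤ x then (1:ℝ) else 0) - x) :=
    (Measurable.ite measurableSet_Iic measurable_const measurable_const).sub_const _
  have h1 := hoeff N _ hm (-x) (fun y => by split_ifs <;> constructor <;> linarith) (step_int x hx) u hu
  have h2 := hoeff N _ hm.neg (x-1) (fun y => by simp only [Pi.neg_apply]; split_ifs <;> constructor <;> linarith)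
    (by simp only [Pi.neg_apply]; rw [integral_neg, step_int x hx, neg_zero]) u hu
  have hsub : {a : Fin N → ℝ | u ≤ |∑ i, ((if a i ≤ x then (1:ℝ) else 0) - x)|} ⊆
     {a | u ≤ ∑ i, ((if a i ≤ x then (1:ℝ) else 0) - x)} ∪ {a | u ≤ ∑ i, (-(fun y : ℝ => (if y ≤ x then (1:ℝ) else 0) - x)) (a i)} := by
    intro a ha
    simp only [Pi.neg_apply, Finset.sum_neg_distrib, mem_union, mem_ofPred_eq] at ha ⊢
    exact le_abs.1 ha
  have := (measureReal_mono (μ := QQ N) hsub (measure_ne_top _ _)).trans (measureReal_union_le _ _)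
  linarith

/-- bad event one -/
def bad1 (N : ℕ) (u : ℝ) : Set (Fin N → ℝ) :=
  ⋃ k ∈ Finset.range (N+2), {a | u ≤ |∑ i, ((if a i ≤ (k:ℝ)/(N+1) then (1:ℝ) else 0) - (k:ℝ)/(N+1))|}

lemma bad1_le (N : ℕ) (u : ℝ) (hu : 0 ≤ u) : (QQ N).real (bad1 N u) ≤ (N+2) * (2 * Real.exp (-(2 * u^2 / N))) := by
  refine (measureReal_biUnion_finset_le _ _).trans ?_
  calc _ ≤ ∑ k ∈ Finset.range (N+2), 2 * Real.exp (-(2 * u^2 / N)) := by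
        refine Finset.sum_le_sum fun k hk => count_dev N _ u ⟨by positivity, ?_⟩ hu
        rw [div_le_one (by positivity)]
        have := Finset.mem_range.1 hk
        have : k ≤ N+1 := by omega
        exact_mod_cast this
    _ = _ := by simp

/-- counting function of a die -/
noncomputable def gA (n : ℕ) (A : Fin n → ℝ) (x : ℝ) : ℝ :=
  ∑ i, ((if x < A i then (1:ℝ) else 0) - (if A i < x then (1:ℝ) else 0))

lemma good1 (N : ℕ) (u : ℝ) (a : Fin N → ℝ) (ha : a ∉ bad1 N u) (b x : ℝ) (hx : x ∈ Ioc (0:ℝ) 1) :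
    |(∑ i, ((if x < a i then (1:ℝ) else 0) - (if a i < x then (1:ℝ) else 0)) + 
      ((if x < b then (1:ℝ) else 0) - (if b < x then (1:ℝ) else 0))) - ((N:ℝ)+1) * (1 - 2*x)| ≤ 2 * u + 6 := by
  have hdev : ∀ k : ℕ, k < N+2 → |∑ i, ((if a i ≤ (k:ℝ)/(N+1) then (1:ℝ) else 0) - (k:ℝ)/(N+1))| < u := by
    intro k hk
    by_contra hcon
    exact ha (mem_biUnion (Finset.mem_coe.2 (Finset.mem_range.2 hk)) (not_lt.1 hcon))
  have hn : (0:ℝ) < N + 1 := by positivity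
  obtain ⟨k, hk⟩ : ∃ k : ℕ, ⌈((N:ℝ)+1) * x⌉₊ = k + 1 := by
    have : 0 < ⌈((N:ℝ)+1) * x⌉₊ := Nat.ceil_pos.2 (mul_pos hn hx.1)
    exact ⟨_, (Nat.succ_pred_eq_of_pos this).symm⟩
  have hk1 : ((N:ℝ)+1) * x ≤ (k:ℝ)+1 := by
    have := Nat.le_ceil (((N:ℝ)+1) * x); rw [hk] at this; push_cast at this; exact this
  have hk2 : (k:ℝ) < ((N:ℝ)+1) * x := by
    have := Nat.lt_ceil (a := ((N:ℝ)+1) * x) (n := k); rw [hk] at this; exact this.1 (by omega)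
  have hkN : k + 1 ≤ N + 1 := by
    rw [← hk, Nat.ceil_le]; push_cast; nlinarith [hx.2]
  have d1 := (abs_lt.1 (hdev k (by omega))).1
  have d2 := (abs_lt.1 (hdev (k+1) (by omega))).2
  rw [Finset.sum_sub_distrib] at d1 d2
  simp only [Finset.sum_const, Finset.card_univ, Fintype.card_fin, nsmul_eq_mul] at d1 d2
  push_cast at d1 d2
  set c0 := ∑ i, (if a i ≤ (k:ℝ)/(N+1) then (1:ℝ) else 0) with hc0
  set c3 := ∑ i, (if a i ≤ ((k:ℝ)+1)/(N+1) then (1:ℝ) else 0) with hc3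
  have hx1 : (k:ℝ)/(N+1) < x := by rw [div_lt_iff₀ hn]; linarith
  have hx2 : x ≤ ((k:ℝ)+1)/(N+1) := by rw [le_div_iff₀ hn]; linarith
  have n1 : (N:ℝ) * ((k:ℝ)/(N+1)) ≥ N * x - 1 := by
    have : (k:ℝ)/(N+1) ≥ x - 1/(N+1) := by
      rw [ge_iff_le, sub_le_iff_le_add, ← add_div]; exact hx2
    have h3 : (N:ℝ) * (1/(N+1)) ≤ 1 := by rw [mul_one_div, div_le_one hn]; linarith
    nlinarith [mul_le_mul_of_nonneg_left this (show (0:ℝ) ≤ N by positivity)]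
  have n2 : (N:ℝ) * (((k:ℝ)+1)/(N+1)) ≤ N * x + 1 := by
    have : ((k:ℝ)+1)/(N+1) ≤ x + 1/(N+1) := by
      rw [add_div]; linarith
    have h3 : (N:ℝ) * (1/(N+1)) ≤ 1 := by rw [mul_one_div, div_le_one hn]; linarith
    nlinarith [mul_le_mul_of_nonneg_left this (show (0:ℝ) ≤ N by positivity)]
  set c1 := ∑ i, (if a i < x then (1:ℝ) else 0) with hc1
  set c2 := ∑ i, (if a i ≤ x then (1:ℝ) else 0) with hc2
  have o1 : c0 ≤ c1 := Finset.sum_le_sum fun i _ => by split_ifs <;> first | linarith | norm_num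
  have o2 : c1 ≤ c2 := Finset.sum_le_sum fun i _ => by split_ifs <;> first | linarith | norm_num
  have o3 : c2 ≤ c3 := Finset.sum_le_sum fun i _ => by split_ifs <;> first | linarith | norm_num
  have e1 : ∑ i, ((if x < a i then (1:ℝ) else 0) - (if a i < x then (1:ℝ) else 0)) = N - c2 - c1 := by
    rw [Finset.sum_sub_distrib]
    have : ∑ i, (if x < a i then (1:ℝ) else 0) = ∑ i, (1 - (if a i ≤ x then (1:ℝ) else 0)) :=
      Finset.sum_congr rfl fun i _ => by split_ifs <;> first | linarith | norm_num
    rw [this, Finset.sum_sub_distrib, ← hc1, ← hc2]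
    simp only [Finset.sum_const, Finset.card_univ, Fintype.card_fin, nsmul_eq_mul, mul_one]
  rw [e1]
  have e2 : |(if x < b then (1:ℝ) else 0) - (if b < x then (1:ℝ) else 0)| ≤ 1 := by
    split_ifs <;> norm_num
  obtain ⟨e3, e4⟩ := abs_le.1 e2
  have hx0 := hx.1
  have hx1 := hx.2
  rw [abs_le]
  constructor <;> nlinarith

/-- one step -/
noncomputable def stp (a x : ℝ) : ℝ := (if x < a then (1:ℝ) else 0) - (if a < x then (1:ℝ) else 0)

lemma stp_meas (a : ℝ) : Measurable (stp a) :=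
  (Measurable.ite measurableSet_Iio measurable_const measurable_const).sub
    (Measurable.ite measurableSet_Ioi measurable_const measurable_const)

lemma stp_le (a x : ℝ) : |stp a x| ≤ 1 := by unfold stp; split_ifs <;> norm_num

lemma stp_cont (a x : ℝ) (h : x ≠ a) : ContinuousAt (stp a) x := by
  rcases lt_or_gt_of_ne h with h | h
  · have : ContinuousAt (fun _ : ℝ => (1:ℝ)) x := continuousAt_const
    refine this.congr ?_
    filter_upwards [isOpen_Iio.mem_nhds h] with y hy
    have hy : y < a := hy
    simp [stp, hy, not_lt.2 hy.le]
  · have : ContinuousAt (fun _ : ℝ => (-1:ℝ)) x := continuousAt_const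
    refine this.congr ?_
    filter_upwards [isOpen_Ioi.mem_nhds h] with y hy
    have hy : a < y := hy
    simp [stp, hy, not_lt.2 hy.le]

lemma stp_int (a : ℝ) (ha : a ∈ Icc (0:ℝ) 1) (F : ℝ → ℝ) (hF : Continuous F) :
    ∫ x in Ioc (0:ℝ) 1, stp a x * F x = (∫ x in (0:ℝ)..a, F x) - ∫ x in a..1, F x := by
  have hi : Integrable F (volume.restrict (Ioc (0:ℝ) 1)) := 
    (intervalIntegrable_iff_integrableOn_Ioc_of_le zero_le_one).1 (hF.intervalIntegrable 0 1)
  have e : ∀ x, stp a x * F x = (Iio a).indicator F x - (Ioi a).indicator F x := by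
    intro x
    simp only [stp, indicator_apply, mem_Iio, mem_Ioi]
    split_ifs <;> ring
  simp_rw [e]
  rw [integral_sub (hi.indicator measurableSet_Iio) (hi.indicator measurableSet_Ioi),
    integral_indicator measurableSet_Iio, integral_indicator measurableSet_Ioi,
    Measure.restrict_restrict measurableSet_Iio, Measure.restrict_restrict measurableSet_Ioi]
  have e1 : Iio a ∩ Ioc (0:ℝ) 1 = Ioo 0 a := by
    ext x; simp only [mem_inter_iff, mem_Iio, mem_Ioc, mem_Ioo]
    constructor
    · rintro ⟨h1, h2, h3⟩; exact ⟨h2, h1⟩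
    · rintro ⟨h1, h2⟩; exact ⟨h2, h1, by linarith [ha.2]⟩
  have e2 : Ioi a ∩ Ioc (0:ℝ) 1 = Ioc a 1 := by
    ext x; simp only [mem_inter_iff, mem_Ioi, mem_Ioc]
    constructor
    · rintro ⟨h1, h2, h3⟩; exact ⟨h1, h3⟩
    · rintro ⟨h1, h2⟩; exact ⟨h1, by linarith [ha.1], h2⟩
  rw [e1, e2, ← integral_Ioc_eq_integral_Ioo, intervalIntegral.integral_of_le ha.1, intervalIntegral.integral_of_le ha.2]

section J
variable (n : ℕ) (A : Fin n → ℝ)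

lemma gA_eq (x : ℝ) : gA n A x = ∑ i, stp (A i) x := rfl

lemma gA_meas : Measurable (gA n A) :=
  Finset.measurable_sum (f := fun i x => stp (A i) x) _ fun i _ => stp_meas (A i)

lemma gA_le (x : ℝ) : |gA n A x| ≤ n := by
  rw [gA_eq]
  refine (Finset.abs_sum_le_sum_abs _ _).trans ?_
  calc _ ≤ ∑ i : Fin n, (1:ℝ) := Finset.sum_le_sum fun i _ => stp_le _ _
    _ = n := by simp

lemma gA_cont (x : ℝ) (hx : x ∉ range A) : ContinuousAt (gA n A) x := by
  have : gA n A = fun x => ∑ i, stp (A i) x := funext (gA_eq n A)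
  rw [this]
  exact tendsto_finsetSum _ fun i _ => stp_cont (A i) x fun h => hx ⟨i, h.symm⟩

lemma gA_int (hA : ∀ i, A i ∈ Icc (0:ℝ) 1) (F : ℝ → ℝ) (hF : Continuous F) :
    ∫ x in Ioc (0:ℝ) 1, gA n A x * F x = ∑ i, ((∫ x in (0:ℝ)..(A i), F x) - ∫ x in (A i)..1, F x) := by
  have hi : Integrable F (volume.restrict (Ioc (0:ℝ) 1)) := 
    (intervalIntegrable_iff_integrableOn_Ioc_of_le zero_le_one).1 (hF.intervalIntegrable 0 1)
  simp_rw [gA_eq, Finset.sum_mul]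
  rw [integral_finsetSum _ fun i _ => hi.bdd_mul (c := 1) (stp_meas (A i)).aestronglyMeasurable (ae_of_all _ fun x => stp_le _ _)]
  exact Finset.sum_congr rfl fun i _ => stp_int (A i) (hA i) F hF

lemma gA_int_one (hA : ∀ i, A i ∈ Icc (0:ℝ) 1) (hs : ∑ i, A i = (n:ℝ)/2) :
    ∫ x in Ioc (0:ℝ) 1, gA n A x = 0 := by
  have := gA_int n A hA (fun _ => 1) continuous_const
  simp only [mul_one] at this
  rw [this]
  simp only [intervalIntegral.integral_const, smul_eq_mul, mul_one]
  have : ∀ i, A i - 0 - (1 - A i) = 2 * A i - 1 := fun i => by ring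
  simp_rw [this]
  rw [Finset.sum_sub_distrib, ← Finset.mul_sum, hs]; simp; ring

lemma gA_int_cos (hA : ∀ i, A i ∈ Icc (0:ℝ) 1) (k : ℕ) :
    ∫ x in Ioc (0:ℝ) 1, gA n A x * Real.cos (2 * Real.pi * ((k:ℝ)+1) * x) = (∑ i, sn k (A i)) / (Real.pi * ((k:ℝ)+1)) := by
  rw [gA_int n A hA (fun x => Real.cos (2 * Real.pi * ((k:ℝ)+1) * x)) (by fun_prop), Finset.sum_div]
  have hc : (2 * Real.pi * ((k:ℝ)+1)) ≠ 0 := by positivity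
  refine Finset.sum_congr rfl fun i _ => ?_
  rw [intervalIntegral.integral_comp_mul_left (fun x => Real.cos x) hc, intervalIntegral.integral_comp_mul_left (fun x => Real.cos x) hc,
    integral_cos, integral_cos]
  have : Real.sin (2 * Real.pi * ((k:ℝ)+1) * 1) = 0 := by
    rw [Real.sin_eq_zero_iff]; exact ⟨2 * (k+1), by push_cast; ring⟩
  rw [this, mul_zero, Real.sin_zero, sn]
  simp only [smul_eq_mul]
  field_simp; ring

lemma U_cos_int (k : ℕ) : ∫ x in Ioc (0:ℝ) 1, (x - 1/2) * Real.cos (2 * Real.pi * ((k:ℝ)+1) * x) = 0 := by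
  rw [← intervalIntegral.integral_of_le zero_le_one]
  set c := 2 * Real.pi * ((k:ℝ)+1) with hc
  have hc0 : c ≠ 0 := by positivity
  have hd : ∀ x ∈ uIcc (0:ℝ) 1, HasDerivAt (fun x => (x - 1/2) * (Real.sin (c*x)/c) + Real.cos (c*x)/c^2) ((x - 1/2) * Real.cos (c * x)) x := by
    intro x _
    have h1 : HasDerivAt (fun x : ℝ => x - 1/2) 1 x := (hasDerivAt_id x).sub_const _
    have h0 : HasDerivAt (fun x : ℝ => c * x) c x := by simpa using (hasDerivAt_id x).const_mul c
    have h2 := (h0.sin).div_const c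
    have h3 := (h0.cos).div_const (c^2)
    have := (h1.mul h2).add h3
    refine HasDerivAt.congr_deriv this ?_
    field_simp; ring
  rw [intervalIntegral.integral_eq_sub_of_hasDerivAt hd (Continuous.intervalIntegrable (by fun_prop) _ _)]
  have s1 : Real.sin (c * 1) = 0 := by
    rw [Real.sin_eq_zero_iff]; exact ⟨2 * (k+1), by rw [hc]; push_cast; ring⟩
  have c1 : Real.cos (c * 1) = 1 := by
    rw [Real.cos_eq_one_iff]; exact ⟨k+1, by rw [hc]; push_cast; ring⟩
  rw [s1, c1]; simp

/-- slope -/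
noncomputable def lam : ℝ := 12 * ∫ x in Ioc (0:ℝ) 1, gA n A x * (x - 1/2)

/-- centred function -/
noncomputable def fA (x : ℝ) : ℝ := gA n A x - lam n A * (x - 1/2)

lemma fA_meas : Measurable (fA n A) := (gA_meas n A).sub (by fun_prop)

lemma fA_cont (x : ℝ) (hx : x ∉ range A) : ContinuousAt (fA n A) x :=
  (gA_cont n A x hx).sub (by fun_prop)

lemma gA_integrable : Integrable (gA n A) (volume.restrict (Ioc (0:ℝ) 1)) :=
  unif_bdd_integrable _ (gA_meas n A) n fun x _ => gA_le n A x

lemma gA_mul_integrable (F : ℝ → ℝ) (hF : Continuous F) : Integrable (fun x => gA n A x * F x) (volume.restrict (Ioc (0:ℝ) 1)) := by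
  have hi : Integrable F (volume.restrict (Ioc (0:ℝ) 1)) := 
    (intervalIntegrable_iff_integrableOn_Ioc_of_le zero_le_one).1 (hF.intervalIntegrable 0 1)
  exact hi.bdd_mul (c := n) (gA_meas n A).aestronglyMeasurable (ae_of_all _ fun x => gA_le n A x)

lemma cont_integrable (F : ℝ → ℝ) (hF : Continuous F) : Integrable F (volume.restrict (Ioc (0:ℝ) 1)) :=
  (intervalIntegrable_iff_integrableOn_Ioc_of_le zero_le_one).1 (hF.intervalIntegrable 0 1)

lemma fA_int (hA : ∀ i, A i ∈ Icc (0:ℝ) 1) (hs : ∑ i, A i = (n:ℝ)/2) :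
    ∫ x in Ioc (0:ℝ) 1, fA n A x = 0 := by
  unfold fA
  rw [integral_sub (gA_integrable n A) (cont_integrable _ (by fun_prop)), gA_int_one n A hA hs, integral_const_mul, U_int]
  simp

lemma fA_int_U : ∫ x in Ioc (0:ℝ) 1, fA n A x * (x - 1/2) = 0 := by
  have e : ∀ x, fA n A x * (x - 1/2) = gA n A x * (x - 1/2) - lam n A * (x-1/2)^2 := fun x => by unfold fA; ring
  simp_rw [e]
  rw [integral_sub (gA_mul_integrable n A _ (by fun_prop)) (cont_integrable _ (by fun_prop)), integral_const_mul, U_sq_int, lam]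
  ring

lemma fA_sq_ge (hA : ∀ i, A i ∈ Icc (0:ℝ) 1) (k : ℕ) :
    ((∑ i, sn k (A i)) / (Real.pi * ((k:ℝ)+1)))^2 ≤ ∫ x in Ioc (0:ℝ) 1, fA n A x ^ 2 := by
  set I := (∑ i, sn k (A i)) / (Real.pi * ((k:ℝ)+1)) with hI
  set co : ℝ → ℝ := fun x => Real.cos (2 * Real.pi * ((k:ℝ)+1) * x) with hco
  have hcc : Continuous co := by rw [hco]; fun_prop
  have hfm := fA_meas n A
  have hU : ∀ x ∈ Ioc (0:ℝ) 1, |x - 1/2| ≤ 1/2 := fun x hx => abs_le.2 ⟨by linarith [hx.1], by linarith [hx.2]⟩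
  have hfb : ∀ x ∈ Ioc (0:ℝ) 1, |fA n A x| ≤ n + |lam n A| * (1/2) := by
    intro x hx
    unfold fA
    refine (abs_sub _ _).trans (add_le_add (gA_le n A x) ?_)
    rw [abs_mul]; exact mul_le_mul_of_nonneg_left (hU x hx) (abs_nonneg _)
  have i1 : Integrable (fun x => fA n A x ^ 2) (volume.restrict (Ioc (0:ℝ) 1)) :=
    unif_bdd_integrable _ (hfm.pow_const 2) ((n + |lam n A| * (1/2))^2) fun x hx => by
      rw [abs_pow]; exact pow_le_pow_left₀ (abs_nonneg _) (hfb x hx) 2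
  have i2 : Integrable (fun x => fA n A x * co x) (volume.restrict (Ioc (0:ℝ) 1)) :=
    unif_bdd_integrable _ (hfm.mul hcc.measurable) ((n + |lam n A| * (1/2)) * 1) fun x hx => by
      rw [abs_mul]; exact mul_le_mul (hfb x hx) (Real.abs_cos_le_one _) (abs_nonneg _) (by positivity)
  have h2 : ∫ x in Ioc (0:ℝ) 1, fA n A x * co x = I := by
    have e : ∀ x, fA n A x * co x = gA n A x * co x - lam n A * ((x-1/2) * co x) := fun x => by unfold fA; ring
    simp_rw [e]
    rw [integral_sub (gA_mul_integrable n A _ hcc) (cont_integrable _ (by fun_prop)), integral_const_mul, hco, U_cos_int,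
      gA_int_cos n A hA, hI]; ring
  have h3 : ∫ x in Ioc (0:ℝ) 1, (2 * I * (fA n A x * co x) - I^2) ≤ ∫ x in Ioc (0:ℝ) 1, fA n A x ^ 2 := by
    refine integral_mono ((i2.const_mul _).sub (integrable_const _)) i1 fun x => ?_
    have hc1 : (co x)^2 ≤ 1 := by rw [hco]; exact Real.cos_sq_le_one _
    dsimp only
    nlinarith [sq_nonneg (fA n A x - I * co x), mul_le_mul_of_nonneg_left hc1 (sq_nonneg I)]
  rw [integral_sub (i2.const_mul _) (integrable_const _), integral_const_mul, h2] at h3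
  simp at h3
  nlinarith

lemma fA_bdd (K0 : ℝ) (hg : ∀ x ∈ Ioc (0:ℝ) 1, |gA n A x - n * (1 - 2*x)| ≤ K0) :
    ∀ x ∈ Ioc (0:ℝ) 1, |fA n A x| ≤ 4 * K0 := by
  have hU : ∀ x ∈ Ioc (0:ℝ) 1, |x - 1/2| ≤ 1/2 := fun x hx => abs_le.2 ⟨by linarith [hx.1], by linarith [hx.2]⟩
  have hlam : |lam n A + 2 * n| ≤ 6 * K0 := by
    have e : lam n A + 2 * n = 12 * ∫ x in Ioc (0:ℝ) 1, (gA n A x - n * (1 - 2*x)) * (x - 1/2) := by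
      have e1 : ∀ x : ℝ, (gA n A x - n * (1 - 2*x)) * (x - 1/2) = gA n A x * (x - 1/2) + (2*n) * (x-1/2)^2 := fun x => by ring
      simp_rw [e1]
      rw [integral_add (gA_mul_integrable n A _ (by fun_prop)) (cont_integrable _ (by fun_prop)), integral_const_mul, U_sq_int, lam]
      ring
    have hb : ∀ᵐ x ∂(volume.restrict (Ioc (0:ℝ) 1)), ‖(gA n A x - n * (1 - 2*x)) * (x - 1/2)‖ ≤ K0 * (1/2) := by
      filter_upwards [ae_restrict_mem measurableSet_Ioc] with x hx
      rw [Real.norm_eq_abs, abs_mul]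
      exact mul_le_mul (hg x hx) (hU x hx) (abs_nonneg _) ((abs_nonneg _).trans (hg x hx))
    have := norm_integral_le_of_norm_le_const hb
    simp at this
    rw [e, abs_mul]
    norm_num
    norm_num at this
    linarith
  intro x hx
  have e : fA n A x = (gA n A x - n * (1 - 2*x)) - (lam n A + 2*n) * (x - 1/2) := by unfold fA; ring
  rw [e]
  refine (abs_sub _ _).trans ?_
  rw [abs_mul]
  have := mul_le_mul hlam (hU x hx) (abs_nonneg _) ((abs_nonneg _).trans hlam)
  linarith [hg x hx]

lemma fA_score (N : ℕ) (b : Fin N → ℝ) : score N (fA n A) b = score N (gA n A) b := by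
  unfold score fA
  rw [Finset.sum_sub_distrib, ← Finset.mul_sum, Finset.sum_sub_distrib]
  simp; ring

lemma gA_score_le (N : ℕ) (b : Fin N → ℝ) : |score N (gA n A) b| ≤ N * n + n := by
  unfold score
  refine (abs_add_le _ _).trans (add_le_add ?_ (gA_le n A _))
  refine (Finset.abs_sum_le_sum_abs _ _).trans ?_
  calc _ ≤ ∑ i : Fin N, (n:ℝ) := Finset.sum_le_sum fun i _ => gA_le _ _ _
    _ = _ := by simp
end J

lemma ext_sum (N : ℕ) (S : ℝ) (a : Fin N → ℝ) (F : ℝ → ℝ) :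
    ∑ i : Fin (N+1), F (extendDie (N+1) S a i) = ∑ i, F (a i) + F (S - ∑ j, a j) := by
  rw [Fin.sum_univ_castSucc]
  congr 1
  · refine Finset.sum_congr rfl fun i _ => ?_
    congr 1
    unfold extendDie
    rw [dif_pos (by simp)]
    rfl
  · congr 1
    unfold extendDie
    rw [dif_neg (by simp)]
    rfl

lemma ext_meas (N : ℕ) (S : ℝ) : Measurable (extendDie (N+1) S) := by
  refine measurable_pi_lambda _ fun i => ?_
  unfold extendDie
  by_cases h : (i:ℕ) < N + 1 - 1
  · simp only [h, dite_true]; exact measurable_pi_apply _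
  · simp only [h, dite_false]; fun_prop

lemma ext_mem (N : ℕ) (a : Fin N → ℝ) (ha : a ∈ slice N) :
    ∀ i, extendDie (N+1) (((N+1:ℕ):ℝ)/2) a i ∈ Icc (0:ℝ) 1 := by
  intro i
  unfold extendDie
  split_ifs with h
  · exact ha.1 _
  · exact ha.2

lemma beats_iff (N : ℕ) (A : Fin (N+1) → ℝ) (b : Fin N → ℝ) :
    beats A (extendDie (N+1) (((N+1:ℕ):ℝ)/2) b) ↔ 0 < score N (gA (N+1) A) b := by
  unfold beats
  rw [Finset.sum_comm]
  have := ext_sum N (((N+1:ℕ):ℝ)/2) b (gA (N+1) A)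
  unfold gA at this
  rw [this]
  rfl

lemma dice_beats (N : ℕ) (A : Fin (N+1) → ℝ) :
    ((diceMeasure (N+1) 0 1 (((N+1:ℕ):ℝ)/2)) {B | beats A B}).toReal
      = (ProbabilityTheory.cond volume (slice N)).real {b | 0 < score N (gA (N+1) A) b} := by
  have hm : MeasurableSet {B : Fin (N+1) → ℝ | beats A B} := by
    unfold beats
    refine measurableSet_lt measurable_const ?_
    refine Finset.measurable_sum _ fun i _ => Finset.measurable_sum _ fun j _ => ?_
    exact (Measurable.ite (measurableSet_lt (measurable_pi_apply j) measurable_const) measurable_const measurable_const).sub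
      (Measurable.ite (measurableSet_lt measurable_const (measurable_pi_apply j)) measurable_const measurable_const)
  unfold diceMeasure
  rw [Measure.map_apply (ext_meas N _) hm, Measure.real]
  have : (extendDie (N+1) (((N+1:ℕ):ℝ)/2)) ⁻¹' {B | beats A B} = {b | 0 < score N (gA (N+1) A) b} := by
    ext b; exact beats_iff N A b
  rw [this]
  rfl

/-- transfer of bad events from the cube to the slice -/
lemma cond_le_QQ (l : ℕ) (hq : 0.995^l * √((l:ℝ)+3) ≤ 1/8) (B : Set (Fin (l+2) → ℝ)) :
    (ProbabilityTheory.cond volume (slice (l+2))).real B ≤ 2 * Real.pi * √((l:ℝ)+3) * (QQ (l+2)).real B := by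
  have hv := slice_vol_ge l hq
  have hv0 := slice_vol_pos l hq
  have hQ : QQ (l+2) = (volume : Measure (Fin (l+2) → ℝ)).restrict (Set.pi univ fun _ => Icc (0:ℝ) 1) := by
    rw [volume_pi, Measure.restrict_pi_pi]
    unfold QQ
    congr 1
    ext1 i
    exact Measure.restrict_congr_set Ioc_ae_eq_Icc
  have hsub : slice (l+2) ⊆ Set.pi univ fun _ => Icc (0:ℝ) 1 := fun a ha i _ => ha.1 i
  have h1 : (volume.restrict (slice (l+2))).real B ≤ (QQ (l+2)).real B := by
    rw [hQ]
    refine ENNReal.toReal_mono ?_ (Measure.restrict_mono hsub le_rfl B)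
    rw [← hQ]; exact measure_ne_top _ _
  have h2 : (ProbabilityTheory.cond volume (slice (l+2))).real B = (volume.real (slice (l+2)))⁻¹ * (volume.restrict (slice (l+2))).real B := by
    simp [ProbabilityTheory.cond, Measure.real, ENNReal.toReal_mul, ENNReal.toReal_inv]
  rw [h2]
  refine mul_le_mul ?_ h1 measureReal_nonneg (by positivity)
  rw [inv_le_comm₀ hv0 (by positivity)]
  refine le_trans (le_of_eq ?_) hv
  rw [mul_inv, one_div]

set_option maxHeartbeats 1000000 in
/-- numerical bound for a good die -/
lemma num_bound (n s t L q R K α β V : ℝ) (hs : n = s^2) (ht : L = t^2) (hs40 : 40 ≤ s) (ht1 : 1 ≤ t)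
    (hq0 : 0 ≤ q) (hq : q * n^2 ≤ 1/64) (hR : R = 2*t) (hK : K = 20*s*t) (hV : V = n/(640*L)^2)
    (hα : α = n*V/10) (hβ : β = n/120) (hexp : Real.exp (-L) ≤ 1/n) :
    s * (n * K * ((K^2/α + 1/β) * √(Real.pi / (β/2)))) / √α
      + s * (n * K * (q * (2 * Real.pi))) / (100*K*R)
      + s * √(Real.pi / β) * (100*K*R) / √α + s * (q * (2 * Real.pi))
      + 4 * Real.exp (-(R^2/4)) ≤ 10^16 * L^5/s := by
  have hpi := Real.pi_lt_d2
  have hpi0 := Real.pi_pos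
  have hs0 : 0 < s := by linarith
  have ht0 : 0 < t := by linarith
  have hL1 : 1 ≤ L := by rw [ht]; nlinarith
  have hL0 : 0 < L := by linarith
  have hn0 : 0 < n := by rw [hs]; positivity
  have hn : 1600 ≤ n := by rw [hs]; nlinarith
  have hα0 : 0 < α := by rw [hα, hV]; positivity
  have hsα : n/(2100*L) ≤ √α := by
    apply Real.le_sqrt_of_sq_le
    rw [hα, hV]
    rw [div_pow, mul_pow, mul_pow, div_le_iff₀ (by positivity)]
    field_simp
    norm_num
  have hiα : 1/√α ≤ 2100*L/n := by
    rw [div_le_div_iff₀ (by positivity) hn0]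
    rw [div_le_iff₀ (by positivity)] at hsα
    linarith
  have hp1 : √(Real.pi / (β/2)) ≤ 32/s := by
    rw [Real.sqrt_le_left (by positivity), hβ, hs, div_pow]
    rw [div_le_div_iff₀ (by positivity) (by positivity)]
    nlinarith [sq_nonneg s, mul_pos hs0 hs0]
  have hp2 : √(Real.pi / β) ≤ 20/s := by
    rw [Real.sqrt_le_left (by positivity), hβ, hs, div_pow]
    rw [div_le_div_iff₀ (by positivity) (by positivity)]
    nlinarith [sq_nonneg s, mul_pos hs0 hs0]
  have hL3 : 1 ≤ L^3 := one_le_pow₀ hL1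
  have hka : K^2/α + 1/β ≤ 1700000000*L^3/n := by
    have e1 : K^2/α = 1638400000*L^3/n := by
      rw [hK, hα, hV, mul_pow, mul_pow, ← hs, ← ht]; field_simp; norm_num
    have e2 : 1/β = 120/n := by rw [hβ]; field_simp
    rw [e1, e2, ← add_div]
    apply div_le_div_of_nonneg_right _ hn0.le
    linarith
  have htL : t ≤ L := by rw [ht]; nlinarith
  have hK0 : 0 < K := by rw [hK]; positivity
  have hβ0 : 0 < β := by rw [hβ]; positivity
  have T1 : s * (n * K * ((K^2/α + 1/β) * √(Real.pi / (β/2)))) / √α ≤ 3*10^15 * L^5/s := by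
    rw [div_eq_mul_one_div]
    calc _ ≤ s * (n * K * ((1700000000*L^3/n) * (32/s))) * (2100*L/n) := by gcongr
      _ = 2284800000000000 * (L^4 * t) / s := by rw [hK, hs]; field_simp; norm_num
      _ ≤ 3*10^15 * (L^4 * L)/s := by gcongr; norm_num
      _ = _ := by ring
  have T2 : s * (n * K * (q * (2 * Real.pi))) / (100*K*R) ≤ 1/s := by
    have e : s * (n * K * (q * (2 * Real.pi))) / (100*K*R) = s * n * q * (2*Real.pi) / (200 * t) := by
      rw [hR]; field_simp; ring
    rw [e, div_le_div_iff₀ (by positivity) hs0]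
    have e2 : s * n * q * (2*Real.pi) * s = (q * n^2) * (2 * Real.pi) := by rw [hs]; ring
    rw [e2]
    have := mul_le_mul_of_nonneg_right hq (show 0 ≤ 2 * Real.pi by positivity)
    linarith
  have T3 : s * √(Real.pi / β) * (100*K*R) / √α ≤ 10^15 * L^5/s := by
    rw [div_eq_mul_one_div]
    have hR0 : 0 < R := by rw [hR]; positivity
    calc _ ≤ s * (20/s) * (100*K*R) * (2100*L/n) := by gcongr
      _ = 168000000 * L^2 / s := by rw [hK, hR, hs, ht]; field_simp; norm_num
      _ ≤ 10^15 * L^5/s := by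
        gcongr
        · norm_num
        · norm_num
  have T4 : s * (q * (2 * Real.pi)) ≤ 1/s := by
    rw [le_div_iff₀ hs0]
    have e2 : s * (q * (2*Real.pi)) * s = (q * n) * (2 * Real.pi) := by rw [hs]; ring
    rw [e2]
    have : q * n ≤ q * n^2 := by
      apply mul_le_mul_of_nonneg_left _ hq0
      exact le_self_pow₀ (by linarith) (by norm_num)
    have := mul_le_mul_of_nonneg_right (this.trans hq) (show 0 ≤ 2 * Real.pi by positivity)
    linarith
  have T5 : 4 * Real.exp (-(R^2/4)) ≤ 4/s := by
    have : R^2/4 = L := by rw [hR, ht]; ring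
    rw [this]
    have : 1/n ≤ 1/s := one_div_le_one_div_of_le hs0 (by rw [hs]; nlinarith)
    calc _ ≤ 4 * (1/s) := by linarith
      _ = 4/s := by ring
  have h5 : 1/s ≤ L^5/s := by gcongr; exact one_le_pow₀ hL1
  have e4 : 4/s = 4*(1/s) := by ring
  have e5 : ∀ c : ℝ, c * L^5/s = c * (L^5/s) := fun c => by ring
  rw [e5] at T1 T3 ⊢
  rw [e4] at T5
  linarith [show 0 ≤ L^5/s by positivity]

/-- largeness conditions -/
structure Lrg (l : ℕ) (n s t L : ℝ) : Prop where
  hn : n = (l:ℝ) + 3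
  hs : n = s^2
  ht : L = t^2
  hL : L = Real.log n
  hs40 : 40 ≤ s
  ht1 : 1 ≤ t
  hq : 0.995^l * n^2 ≤ 1/64
  hbig : 153600 * L^3 ≤ n

section
variable {l : ℕ} {n s t L : ℝ}

lemma Lrg.sqrt (h : Lrg l n s t L) : √((l:ℝ)+3) = s := by
  rw [← h.hn, h.hs, Real.sqrt_sq (by linarith [h.hs40])]

lemma Lrg.n_ge (h : Lrg l n s t L) : 1600 ≤ n := by rw [h.hs]; nlinarith [h.hs40]

lemma Lrg.L_ge (h : Lrg l n s t L) : 1 ≤ L := by rw [h.ht]; nlinarith [h.ht1]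

lemma Lrg.expL (h : Lrg l n s t L) : Real.exp L = n := by rw [h.hL, Real.exp_log (by linarith [h.n_ge])]

lemma Lrg.expnL (h : Lrg l n s t L) (k : ℕ) : Real.exp (-(k * L)) = 1/n^k := by
  rw [Real.exp_neg, Real.exp_nat_mul, h.expL, one_div]

lemma Lrg.hq' (h : Lrg l n s t L) : 0.995^l * √((l:ℝ)+3) ≤ 1/8 := by
  rw [h.sqrt]
  have h1 : s ≤ n^2 := by
    rw [h.hs, ← pow_mul]; exact le_self_pow₀ (by linarith [h.hs40]) (by norm_num)
  have : (0.995:ℝ)^l * s ≤ 0.995^l * n^2 := by gcongr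
  linarith [h.hq]

lemma Lrg.bad1p (h : Lrg l n s t L) : (QQ (l+2)).real (bad1 (l+2) (2*s*t)) ≤ 1/n^3 := by
  have hs40 := h.hs40
  have ht1 := h.ht1
  have hn1 := h.n_ge
  have hLg := h.L_ge
  refine (bad1_le (l+2) (2*s*t) (by positivity)).trans ?_
  have e : (2 * (2*s*t)^2 / ((l+2:ℕ):ℝ)) ≥ ((8:ℕ):ℝ) * L := by
    have : (2*s*t)^2 = 4 * (n*L) := by rw [h.hs, h.ht]; ring
    rw [this, ge_iff_le, le_div_iff₀ (by positivity)]
    have : ((l+2:ℕ):ℝ) = n - 1 := by rw [h.hn]; push_cast; ring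
    rw [this]; push_cast; nlinarith
  have e2 : Real.exp (-(2 * (2*s*t)^2 / ((l+2:ℕ):ℝ))) ≤ 1/n^8 := by
    rw [← h.expnL 8]; apply Real.exp_le_exp.2; linarith
  have e3 : (((l+2:ℕ):ℝ)+2) = n + 1 := by rw [h.hn]; push_cast; ring
  rw [e3]
  have hn0 : 0 < n := by linarith
  calc _ ≤ (n+1) * (2 * (1/n^8)) := by gcongr
    _ ≤ (n^2) * (n^3 * (1/n^8)) := by
      gcongr
      · nlinarith
      · nlinarith [sq_nonneg n]
    _ = 1/n^3 := by field_simp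

lemma Lrg.mbounds (h : Lrg l n s t L) : 3 * L ≤ (⌈3*L⌉₊:ℝ) ∧ (⌈3*L⌉₊:ℝ) ≤ 4 * L ∧ 0 < ⌈3*L⌉₊ := by
  have := h.L_ge
  refine ⟨Nat.le_ceil _, ?_, Nat.ceil_pos.2 (by linarith)⟩
  linarith [Nat.ceil_lt_add_one (show 0 ≤ 3*L by linarith)]

lemma Lrg.bad2p (h : Lrg l n s t L) : (QQ (l+2)).real {a | ∀ k : Fin ⌈3*L⌉₊, |∑ i, sn k (a i)| ≤ s/20} ≤ 9/n^3 := by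
  have hs40 := h.hs40
  have ht1 := h.ht1
  have hn1 := h.n_ge
  have hLg := h.L_ge
  obtain ⟨m1, m2, m0⟩ := h.mbounds
  set m := ⌈3*L⌉₊ with hm
  have hn0 : 0 < n := by linarith
  have hm0 : (0:ℝ) < m := by exact_mod_cast m0
  refine (small_ball m (l+2) (s/20) (by positivity) m0).trans ?_
  have e1 : Real.exp 3 ≤ 1 + 2 * (((l+2:ℕ):ℝ)/(10*(s/20)^2)) := by
    have : ((l+2:ℕ):ℝ) = n - 1 := by rw [h.hn]; push_cast; ring
    rw [this]
    have e3 : 10*(s/20)^2 = n/40 := by rw [h.hs]; ring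
    rw [e3]
    have : (40:ℝ)/2 ≤ (n-1)/(n/40) := by
      rw [le_div_iff₀ (by positivity)]; linarith
    have h3 : Real.exp 3 = Real.exp 1 ^ 3 := by rw [← Real.exp_nat_mul]; norm_num
    have : Real.exp 1 ^ 3 ≤ 2.7182818286^3 := by gcongr; exact Real.exp_one_lt_d9.le
    rw [h3]
    norm_num at *
    linarith
  have e2 : (√(1 + 2 * (((l+2:ℕ):ℝ)/(10*(s/20)^2))))⁻¹ ≤ Real.exp (-(3/2)) := by
    rw [Real.exp_neg]
    refine inv_anti₀ (Real.exp_pos _) (Real.le_sqrt_of_sq_le ?_)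
    rw [← Real.exp_nat_mul]; norm_num
    norm_num at e1; exact e1
  have A1 : Real.exp (m/2) * (√(1 + 2 * (((l+2:ℕ):ℝ)/(10*(s/20)^2))))⁻¹^m ≤ 1/n^3 := by
    calc _ ≤ Real.exp (m/2) * Real.exp (-(3/2))^m := by gcongr
      _ = Real.exp (-m) := by rw [← Real.exp_nat_mul, ← Real.exp_add]; ring_nf
      _ ≤ Real.exp (-((3:ℕ)*L)) := by apply Real.exp_le_exp.2; push_cast; linarith
      _ = _ := h.expnL 3
  have e4 : Real.exp (-((s/20/m)^2/4)) ≤ 1/n^6 := by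
    rw [← h.expnL 6]
    apply Real.exp_le_exp.2
    rw [neg_le_neg_iff]
    have : s/20/(4*L) ≤ s/20/m := by gcongr
    have h2 : (s/20/(4*L))^2 ≤ (s/20/m)^2 := by gcongr
    have h3 : (s/20/(4*L))^2 = n/(6400*L^2) := by rw [h.hs]; field_simp; norm_num
    have h4 : 24*L ≤ n/(6400*L^2) := by
      rw [le_div_iff₀ (by positivity)]
      have := h.hbig
      nlinarith
    push_cast
    linarith
  have e5 : Real.exp (m/2) ≤ n^2 := by
    rw [← h.expL, ← Real.exp_nat_mul]; apply Real.exp_le_exp.2; push_cast; linarith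
  have e6 : (m:ℝ) ≤ 4*n := by
    have : L ≤ n := by rw [h.hL]; exact Real.log_le_self hn0.le
    linarith
  have A2 : Real.exp (m/2) * (m * (Real.exp (-((s/20/m)^2/4)) * 2)) ≤ 8/n^3 := by
    calc _ ≤ n^2 * ((4*n) * (1/n^6 * 2)) := by gcongr
      _ = 8/n^3 := by field_simp; norm_num
  rw [mul_add]
  calc _ ≤ 1/n^3 + 8/n^3 := add_le_add A1 A2
    _ = _ := by ring

lemma Lrg.badp (h : Lrg l n s t L) : (ProbabilityTheory.cond volume (slice (l+2))).real
    (bad1 (l+2) (2*s*t) ∪ {a | ∀ k : Fin ⌈3*L⌉₊, |∑ i, sn k (a i)| ≤ s/20}) ≤ 1/n := by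
  refine (cond_le_QQ l h.hq' _).trans ?_
  have h1 := (measureReal_union_le (μ := QQ (l+2)) (bad1 (l+2) (2*s*t)) {a | ∀ k : Fin ⌈3*L⌉₊, |∑ i, sn k (a i)| ≤ s/20}).trans
    (add_le_add h.bad1p h.bad2p)
  rw [h.sqrt]
  have hs40 := h.hs40
  have hn1 := h.n_ge
  have hn0 : 0 < n := by linarith
  have hpi := Real.pi_lt_d2
  have hpi0 := Real.pi_pos
  calc _ ≤ 2 * Real.pi * s * (1/n^3 + 9/n^3) := by gcongr
    _ = (20 * Real.pi * s) / n^3 := by ring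
    _ ≤ n^2/n^3 := by
      gcongr
      have : 20 * Real.pi * s ≤ 63 * s := by nlinarith
      have : 63 * s ≤ 2 * n := by rw [h.hs]; nlinarith
      nlinarith
    _ = 1/n := by field_simp

lemma Lrg.good (h : Lrg l n s t L) (a : Fin (l+2) → ℝ) (ha : a ∈ slice (l+2))
    (hb : a ∉ bad1 (l+2) (2*s*t) ∪ {a | ∀ k : Fin ⌈3*L⌉₊, |∑ i, sn k (a i)| ≤ s/20}) :
    |((diceMeasure (l+2+1) 0 1 (((l+2+1:ℕ):ℝ)/2)) {B | beats (extendDie (l+2+1) (((l+2+1:ℕ):ℝ)/2) a) B}).toReal - 1/2| ≤ 10^16 * L^5/s := by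
  set A := extendDie (l+2+1) (((l+2+1:ℕ):ℝ)/2) a with hA
  rw [dice_beats]
  have hs40 := h.hs40
  have ht1 := h.ht1
  have hn1 := h.n_ge
  have hLg := h.L_ge
  have hn0 : 0 < n := by linarith
  have hAm : ∀ i, A i ∈ Icc (0:ℝ) 1 := ext_mem (l+2) a ha
  have hAs : ∑ i, A i = ((l+2+1:ℕ):ℝ)/2 := by
    have := ext_sum (l+2) (((l+2+1:ℕ):ℝ)/2) a (fun x => x)
    simp only at this
    rw [hA, this]; ring
  have hN : ((l+2+1:ℕ):ℝ) = n := by rw [h.hn]; push_cast; ring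
  rw [mem_union, not_or] at hb
  have hg : ∀ x ∈ Ioc (0:ℝ) 1, |gA (l+2+1) A x - ((l+2+1:ℕ):ℝ) * (1 - 2*x)| ≤ 5*s*t := by
    intro x hx
    have h1 := good1 (l+2) (2*s*t) a hb.1 (((l+2+1:ℕ):ℝ)/2 - ∑ j, a j) x hx
    have h2 := ext_sum (l+2) (((l+2+1:ℕ):ℝ)/2) a (fun y => (if x < y then (1:ℝ) else 0) - (if y < x then (1:ℝ) else 0))
    have h3 : gA (l+2+1) A x = _ := h2
    rw [h3]
    have : (((l+2+1:ℕ):ℝ)) = ((l+2:ℕ):ℝ) + 1 := by push_cast; ring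
    rw [this] at h1 ⊢
    refine h1.trans ?_
    nlinarith
  have hfb := fA_bdd (l+2+1) A (5*s*t) hg
  obtain ⟨m1, m2, m0⟩ := h.mbounds
  have h2 := hb.2
  rw [mem_ofPred_eq] at h2
  push Not at h2
  obtain ⟨k, hk⟩ := h2
  have hVk := fA_sq_ge (l+2+1) A hAm k
  have hV : n/(640*L)^2 ≤ ∫ x in Ioc (0:ℝ) 1, fA (l+2+1) A x ^ 2 := by
    refine le_trans ?_ hVk
    have e1 : ∑ i, sn k (A i) = ∑ i, sn k (a i) + sn k (((l+2+1:ℕ):ℝ)/2 - ∑ j, a j) := ext_sum _ _ _ _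
    have e2 : s/40 ≤ |∑ i, sn k (A i)| := by
      rw [e1]
      have h3 := sn_le k (((l+2+1:ℕ):ℝ)/2 - ∑ j, a j)
      have h4 := abs_sub_abs_le_abs_sub (∑ i, sn k (a i)) (-sn k (((l+2+1:ℕ):ℝ)/2 - ∑ j, a j))
      rw [abs_neg, sub_neg_eq_add] at h4
      linarith
    have e3 : Real.pi * (((k:ℕ):ℝ)+1) ≤ 16 * L := by
      have : (((k:ℕ):ℝ)+1) ≤ (⌈3*L⌉₊:ℝ) := by exact_mod_cast k.2
      have : (((k:ℕ):ℝ)+1) ≤ 4*L := this.trans m2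
      calc _ ≤ 4 * (4 * L) := by
            gcongr
            exact Real.pi_le_four
        _ = _ := by ring
    have e4 : n/(640*L)^2 = (s/40/(16*L))^2 := by rw [h.hs]; field_simp; norm_num
    rw [e4, ← sq_abs ((∑ i, sn k (A i)) / _), abs_div, abs_of_pos (show 0 < Real.pi * (((k:ℕ):ℝ)+1) by positivity)]
    gcongr
  have hM : ∀ b, |score (l+2) (fA (l+2+1) A) b| ≤ ((l+2:ℕ):ℝ) * ((l+2+1:ℕ):ℝ) + ((l+2+1:ℕ):ℝ) := by
    intro b; rw [fA_score]; exact gA_score_le _ _ _ _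
  have main := E_main (fA (l+2+1) A) (20*s*t) (n/(640*L)^2) l (fA_meas _ A) (fun x hx => by have := hfb x hx; linarith) (by positivity)
    (fA_int _ A hAm hAs) (fA_int_U _ A) hV (by positivity) (range A) (countable_range A) (fA_cont _ A) _ hM h.hq'
    (2*t) (100*(20*s*t)*(2*t)) (by linarith) rfl _ _ rfl rfl
  simp_rw [fA_score] at main
  refine main.trans ?_
  rw [h.sqrt, ← h.hn]
  refine num_bound n s t L (0.995^l) (2*t) (20*s*t) _ _ _ h.hs h.ht hs40 ht1 (by positivity) h.hq rfl rfl rfl rfl rfl ?_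
  have := h.expnL 1
  simp at this
  simp [this]

lemma Lrg.final (h : Lrg l n s t L) : (diceMeasure (l+2+1) 0 1 (((l+2+1:ℕ):ℝ)/2)) {A |
    |((diceMeasure (l+2+1) 0 1 (((l+2+1:ℕ):ℝ)/2)) {B | beats A B}).toReal - 1/2| ≤ 10^16 * L^5/s} ≥ 1 - ((l+2+1:ℕ):ℝ≥0∞)⁻¹ := by
  have hn1 := h.n_ge
  have hN : ((l+2+1:ℕ):ℝ) = n := by rw [h.hn]; push_cast; ring
  have hprob := slice_prob l h.hq'
  set P := ProbabilityTheory.cond volume (slice (l+2)) with hP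
  set Bad := bad1 (l+2) (2*s*t) ∪ {a | ∀ k : Fin ⌈3*L⌉₊, |∑ i, sn k (a i)| ≤ s/20} with hB
  set S := {A : Fin (l+2+1) → ℝ |
    |((diceMeasure (l+2+1) 0 1 (((l+2+1:ℕ):ℝ)/2)) {B | beats A B}).toReal - 1/2| ≤ 10^16 * L^5/s} with hS
  have h1 : P ((extendDie (l+2+1) (((l+2+1:ℕ):ℝ)/2)) ⁻¹' S) ≤ (diceMeasure (l+2+1) 0 1 (((l+2+1:ℕ):ℝ)/2)) S :=
    Measure.le_map_apply (ext_meas (l+2) _).aemeasurable S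
  refine ge_iff_le.2 (le_trans ?_ h1)
  have hbad : P Bad ≤ ((l+2+1:ℕ):ℝ≥0∞)⁻¹ := by
    have := h.badp
    rw [← ENNReal.ofReal_toReal (measure_ne_top P Bad)]
    have e : ((l+2+1:ℕ):ℝ≥0∞)⁻¹ = ENNReal.ofReal (1/n) := by
      rw [one_div, ENNReal.ofReal_inv_of_pos (by linarith), ← hN, ENNReal.ofReal_natCast]
    rw [e]
    exact ENNReal.ofReal_le_ofReal this
  have hsl : P (slice (l+2))ᶜ = 0 := by
    rw [hP, ProbabilityTheory.cond_apply (measurableSet_slice _)]; simp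
  have hcov : (univ : Set (Fin (l+2) → ℝ)) ⊆ ((extendDie (l+2+1) (((l+2+1:ℕ):ℝ)/2)) ⁻¹' S) ∪ (Bad ∪ (slice (l+2))ᶜ) := by
    intro a _
    by_cases h2 : a ∈ slice (l+2)
    · by_cases h3 : a ∈ Bad
      · exact Or.inr (Or.inl h3)
      · exact Or.inl (h.good a h2 h3)
    · exact Or.inr (Or.inr h2)
  have : (1:ℝ≥0∞) ≤ P ((extendDie (l+2+1) (((l+2+1:ℕ):ℝ)/2)) ⁻¹' S) + ((l+2+1:ℕ):ℝ≥0∞)⁻¹ := by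
    calc (1:ℝ≥0∞) = P univ := measure_univ.symm
      _ ≤ _ := measure_mono hcov
      _ ≤ _ := measure_union_le _ _
      _ ≤ P ((extendDie (l+2+1) (((l+2+1:ℕ):ℝ)/2)) ⁻¹' S) + (P Bad + P (slice (l+2))ᶜ) := by
        gcongr; exact measure_union_le _ _
      _ ≤ _ := by rw [hsl, add_zero]; gcongr
  exact tsub_le_iff_right.2 this
end

lemma lrg_eventually : ∃ N0 : ℕ, ∀ l : ℕ, N0 ≤ l →
    Lrg l ((l:ℝ)+3) (√((l:ℝ)+3)) (√(Real.log ((l:ℝ)+3))) (Real.log ((l:ℝ)+3)) := by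
  have ht : Filter.Tendsto (fun l : ℕ => (l:ℝ)+3) Filter.atTop Filter.atTop :=
    Filter.tendsto_atTop_add_const_right _ _ tendsto_natCast_atTop_atTop
  have h1 : ∀ᶠ l : ℕ in Filter.atTop, 1600 ≤ (l:ℝ)+3 := ht.eventually_ge_atTop _
  have h2 : ∀ᶠ l : ℕ in Filter.atTop, 1 ≤ Real.log ((l:ℝ)+3) :=
    (Real.tendsto_log_atTop.comp ht).eventually_ge_atTop _
  have h3 : ∀ᶠ l : ℕ in Filter.atTop, 153600 * Real.log ((l:ℝ)+3)^3 ≤ (l:ℝ)+3 := by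
    have := (Real.isLittleO_pow_log_id_atTop (n := 3)).comp_tendsto ht
    have := this.bound (show (0:ℝ) < 1/153600 by norm_num)
    filter_upwards [this] with l hl
    simp only [Function.comp, id, Real.norm_eq_abs] at hl
    rw [abs_of_pos (show (0:ℝ) < (l:ℝ)+3 by positivity)] at hl
    linarith [le_abs_self (Real.log ((l:ℝ)+3)^3)]
  have h4 : ∀ᶠ l : ℕ in Filter.atTop, (0.995:ℝ)^l * ((l:ℝ)+3)^2 ≤ 1/64 := by
    have := (tendsto_pow_const_mul_const_pow_of_abs_lt_one 2 (show |(0.995:ℝ)| < 1 by norm_num [abs_lt])).eventually_le_const (show (0:ℝ) < 1/64/16 by norm_num)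
    filter_upwards [this, Filter.eventually_ge_atTop 1] with l hl hl1
    have : (1:ℝ) ≤ l := by exact_mod_cast hl1
    have : ((l:ℝ)+3)^2 ≤ 16 * (l:ℝ)^2 := by nlinarith
    have : (0.995:ℝ)^l * ((l:ℝ)+3)^2 ≤ (0.995:ℝ)^l * (16 * (l:ℝ)^2) := by gcongr
    linarith
  obtain ⟨N0, hN0⟩ := Filter.eventually_atTop.1 (h1.and (h2.and (h3.and h4)))
  refine ⟨N0, fun l hl => ?_⟩
  obtain ⟨g1, g2, g3, g4⟩ := hN0 l hl
  refine ⟨rfl, (Real.sq_sqrt (by positivity)).symm, (Real.sq_sqrt (by linarith)).symm, rfl, ?_, ?_, g4, g3⟩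
  · apply Real.le_sqrt_of_sq_le; norm_num; linarith
  · apply Real.le_sqrt_of_sq_le; norm_num; linarith

theorem one_fixed_die_fair :
    ∃ C > (0 : ℝ), ∃ c > (0 : ℝ), ∃ N : ℕ, ∀ n : ℕ, N ≤ n → Odd n →
      (diceMeasure n 0 1 ((n : ℝ) / 2))
          {A : Fin n → ℝ |
            |((diceMeasure n 0 1 ((n : ℝ) / 2)) {B : Fin n → ℝ | beats A B}).toReal - 1 / 2|
              ≤ C * Real.log n ^ c / Real.sqrt n}
        ≥ 1 - (n : ℝ≥0∞)⁻¹ := by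
  obtain ⟨N0, hN0⟩ := lrg_eventually
  refine ⟨10^16, by norm_num, 5, by norm_num, N0 + 3, fun n hn _ => ?_⟩
  obtain ⟨l, rfl⟩ : ∃ l, n = l + 2 + 1 := ⟨n - 3, by omega⟩
  have h := (hN0 l (by omega)).final
  have e : ((l+2+1:ℕ):ℝ) = (l:ℝ) + 3 := by push_cast; ring
  have e5 : Real.log ((l:ℝ)+3) ^ (5:ℝ) = Real.log ((l:ℝ)+3) ^ 5 := by
    rw [← Real.rpow_natCast]; norm_num
  have e6 : Real.log ((l+2+1:ℕ):ℝ) ^ (5:ℝ) = Real.log ((l:ℝ)+3) ^ 5 := by rw [e, e5]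
  have e7 : √((l+2+1:ℕ):ℝ) = √((l:ℝ)+3) := by rw [e]
  rw [e6, e7]
  exact h
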